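/- Under Condition (A) (nQ₁(n) = o(Q₂(n))), let h*(n) be an integer-valued function satisfying (α₁A₂₁/(1-α₁)) h*(n) Q₁(h*(n)) ~ Q₂(n). Then for any s₁ ∈ (0,1), any t > 0, any λ₂ ≥ 0, and m = n - ⌊t h*(n)⌋, one has lim_{n→∞} E[s₁^{Z₁(m,n)} exp(-λ₂ (Q₂(n)/Q₂₁(⌊t h*(n)⌋)) Z₂(m,n)) | Z(n) ≠ 0, Z(0)=e₂] = 1 - (1 + (t^{1-1/α₁}(1-s₁)^{1-α₁} + λ₂)^{-α₂})^{-1/α₂}. -/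

import Mathlib

open MeasureTheory Filter Topology

/-- `a(n) ~ b(n)` : the ratio tends to `1` as `n → ∞`. -/
def Asymp (f g : ℕ → ℝ) : Prop :=
  Filter.Tendsto (fun n => f n / g n) Filter.atTop (nhds 1)

/-- A critical decomposable two-type Galton–Watson process together with its
reduced process.  `P1` is the law of the process started from one particle of
type 1 (`Z(0) = e₁`), `P2` the law started from one particle of type 2
(`Z(0) = e₂`).  `Z1 n`/`Z2 n` are the numbers of particles of types 1 and 2 at
time `n`; `R1 m n`/`R2 m n` are the numbers of particles of types 1 and 2 alive
at time `m` having descendants at time `n` (the reduced process). -/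
structure GWSetup where
  (Ω : Type)
  [mΩ : MeasurableSpace Ω]
  (P1 : Measure Ω)
  (P2 : Measure Ω)
  (hprob1 : IsProbabilityMeasure P1)
  (hprob2 : IsProbabilityMeasure P2)
  (Z1 : ℕ → Ω → ℕ)
  (Z2 : ℕ → Ω → ℕ)
  (R1 : ℕ → ℕ → Ω → ℕ)
  (R2 : ℕ → ℕ → Ω → ℕ)
  (mZ1 : ∀ n, Measurable (Z1 n))
  (mZ2 : ∀ n, Measurable (Z2 n))
  (mR1 : ∀ m n, Measurable (R1 m n))
  (mR2 : ∀ m n, Measurable (R2 m n))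
  (α1 : ℝ)
  (α2 : ℝ)
  (A21 : ℝ)
  (L1 : ℝ → ℝ)
  (L2 : ℝ → ℝ)
  (ρ : ℝ → ℝ → ℝ)
  (hα1 : 0 < α1 ∧ α1 ≤ 1)
  (hα2 : 0 < α2 ∧ α2 ≤ 1)
  (hA21 : 0 < A21)
  -- initial states
  (hinit1 : ∀ᵐ ω ∂P1, Z1 0 ω = 1 ∧ Z2 0 ω = 0)
  (hinit2 : ∀ᵐ ω ∂P2, Z1 0 ω = 0 ∧ Z2 0 ω = 1)
  -- type-1 particles produce only type-1 particles
  (hdecomp : ∀ n, ∀ᵐ ω ∂P1, Z2 n ω = 0)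
  -- criticality
  (hcrit1 : (∫ ω, (Z1 1 ω : ℝ) ∂P1) = 1)
  (hcrit2 : (∫ ω, (Z2 1 ω : ℝ) ∂P2) = 1)
  -- mean number of type-1 children of a type-2 particle
  (hmean21 : (∫ ω, (Z1 1 ω : ℝ) ∂P2) = A21)
  -- assumption (F1)
  (hF1 : ∀ s : ℝ, 0 ≤ s → s < 1 →
    (∫ ω, s ^ Z1 1 ω ∂P1) = s + (1 - s) ^ (1 + α1) * L1 (1 - s))
  -- assumption (F2)
  (hF2 : ∀ s1 s2 : ℝ, 0 ≤ s1 → s1 ≤ 1 → 0 ≤ s2 → s2 < 1 →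
    (∫ ω, s1 ^ Z1 1 ω * s2 ^ Z2 1 ω ∂P2) =
      s2 + (1 - s2) ^ (1 + α2) * L2 (1 - s2) - (A21 - ρ s1 s2) * (1 - s1))
  -- `L1`, `L2` are slowly varying at `0`
  (hL1 : ∀ c : ℝ, 0 < c →
    Filter.Tendsto (fun x => L1 (c * x) / L1 x) (nhdsWithin 0 (Set.Ioi 0)) (nhds 1))
  (hL2 : ∀ c : ℝ, 0 < c →
    Filter.Tendsto (fun x => L2 (c * x) / L2 x) (nhdsWithin 0 (Set.Ioi 0)) (nhds 1))
  -- `ρ(s₁,s₂) → 0` as `s₁ s₂ ↑ 1`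
  (hρ : ∀ ε : ℝ, 0 < ε → ∃ δ : ℝ, 0 < δ ∧ ∀ s1 s2 : ℝ,
    0 ≤ s1 → s1 ≤ 1 → 0 ≤ s2 → s2 ≤ 1 → 1 - δ < s1 * s2 → |ρ s1 s2| < ε)
  -- branching (semigroup) property at the level of generating functions
  (hbranch1 : ∀ m n : ℕ, ∀ s : ℝ, 0 ≤ s → s ≤ 1 →
    (∫ ω, s ^ Z1 (m + n) ω ∂P1) = ∫ ω, (∫ ω', s ^ Z1 n ω' ∂P1) ^ Z1 m ω ∂P1)
  (hbranch2 : ∀ m n : ℕ, ∀ s1 s2 : ℝ, 0 ≤ s1 → s1 ≤ 1 → 0 ≤ s2 → s2 ≤ 1 →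
    (∫ ω, s1 ^ Z1 (m + n) ω * s2 ^ Z2 (m + n) ω ∂P2) =
      ∫ ω, (∫ ω', s1 ^ Z1 n ω' ∂P1) ^ Z1 m ω *
        (∫ ω', s1 ^ Z1 n ω' * s2 ^ Z2 n ω' ∂P2) ^ Z2 m ω ∂P2)
  -- the reduced process vanishes on the extinction event
  (hext : ∀ m n : ℕ, ∀ᵐ ω ∂P2,
    (Z1 n ω = 0 ∧ Z2 n ω = 0) → (R1 m n ω = 0 ∧ R2 m n ω = 0))
  -- the generating function of the reduced process (conditioning on `Z(m)`)
  (hreduced : ∀ m n : ℕ, m ≤ n → ∀ s1 s2 : ℝ, 0 ≤ s1 → s1 ≤ 1 → 0 ≤ s2 → s2 ≤ 1 →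
    (∫ ω, s1 ^ R1 m n ω * s2 ^ R2 m n ω ∂P2) =
      ∫ ω, (1 - (1 - s1) * (P1 {ω' | Z1 (n - m) ω' ≠ 0}).toReal) ^ Z1 m ω *
        (1 - (1 - s2) *
          (P2 {ω' | Z1 (n - m) ω' ≠ 0 ∨ Z2 (n - m) ω' ≠ 0}).toReal) ^ Z2 m ω ∂P2)

namespace GWSetup

variable (S : GWSetup)

/-- The survival event `{Z(n) ≠ 0}` (under the law `P2`). -/
def surv (n : ℕ) : Set S.Ω := {ω | S.Z1 n ω ≠ 0 ∨ S.Z2 n ω ≠ 0}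

/-- `Q₁(n) = P(Z₁(n) > 0 | Z(0) = e₁)`. -/
noncomputable def Q1 (n : ℕ) : ℝ := (S.P1 {ω | S.Z1 n ω ≠ 0}).toReal

/-- `Q₂(n) = P(Z₂(n) > 0 | Z(0) = e₂)`. -/
noncomputable def Q2 (n : ℕ) : ℝ := (S.P2 {ω | S.Z2 n ω ≠ 0}).toReal

/-- `Q₂₁(n) = P(Z(n) ≠ 0 | Z(0) = e₂)`. -/
noncomputable def Q21 (n : ℕ) : ℝ := (S.P2 (S.surv n)).toReal

/-- `F₁(n; s) = E[s^{Z₁(n)} | Z(0) = e₁]`. -/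
noncomputable def F1 (n : ℕ) (s : ℝ) : ℝ := ∫ ω, s ^ S.Z1 n ω ∂S.P1

/-- `F₂₁(n; s₁, s₂) = E[s₁^{Z₁(n)} s₂^{Z₂(n)} | Z(0) = e₂]`. -/
noncomputable def F21 (n : ℕ) (s1 s2 : ℝ) : ℝ :=
  ∫ ω, s1 ^ S.Z1 n ω * s2 ^ S.Z2 n ω ∂S.P2

/-- `Q₁(n; s) = 1 - F₁(n; s)`. -/
noncomputable def Q1s (n : ℕ) (s : ℝ) : ℝ := 1 - S.F1 n s

/-- `Q₂(n; s) = 1 - E[s^{Z₂(n)} | Z(0) = e₂]`. -/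
noncomputable def Q2s (n : ℕ) (s : ℝ) : ℝ := 1 - S.F21 n 1 s

/-- `Q₂₁(n; s₁, s₂) = 1 - F₂₁(n; s₁, s₂)`. -/
noncomputable def Q21s (n : ℕ) (s1 s2 : ℝ) : ℝ := 1 - S.F21 n s1 s2

/-- The conditional expectation
`E[f(Z₁(m,n), Z₂(m,n)) | Z(n) ≠ 0, Z(0) = e₂]` for the reduced process. -/
noncomputable def Ered (m n : ℕ) (f : ℕ → ℕ → ℝ) : ℝ :=
  (∫ ω in S.surv n, f (S.R1 m n ω) (S.R2 m n ω) ∂S.P2) / S.Q21 n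

/-- The conditional probability `P(E | Z(n) ≠ 0, Z(0) = e₂)`. -/
noncomputable def Pred (n : ℕ) (E : Set S.Ω) : ℝ :=
  (S.P2 (E ∩ S.surv n)).toReal / S.Q21 n

/-- The birth time `β_n` of the most recent common ancestor of the population
alive at time `n`:  `β_n = max {m < n : Z₁(m,n) + Z₂(m,n) = 1}`. -/
noncomputable def beta (n : ℕ) (ω : S.Ω) : ℕ :=
  sSup {m | m < n ∧ S.R1 m n ω + S.R2 m n ω = 1}

/-- The type `T_n` of the most recent common ancestor: the `i ∈ {1,2}` with
`Z_i(β_n, n) = 1`. -/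
noncomputable def mrcaType (n : ℕ) (ω : S.Ω) : ℕ :=
  if S.R2 (S.beta n ω) n ω = 1 then 2 else 1

/-- Condition (A): `n Q₁(n) = o(Q₂(n))`. -/
def CondA : Prop :=
  Filter.Tendsto (fun n : ℕ => (n : ℝ) * S.Q1 n / S.Q2 n) Filter.atTop (nhds 0)

/-- Condition (B): `Q₂(n) = o(n Q₁(n))`. -/
def CondB : Prop :=
  Filter.Tendsto (fun n : ℕ => S.Q2 n / ((n : ℝ) * S.Q1 n)) Filter.atTop (nhds 0)

/-- Condition (C): `n Q₁(n) ~ σ Q₂(n)`. -/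
def CondC (σ : ℝ) : Prop := Asymp (fun n : ℕ => (n : ℝ) * S.Q1 n) (fun n => σ * S.Q2 n)

/-- `h*` is an integer-valued function with
`(α₁ A₂₁ / (1 - α₁)) h*(n) Q₁(h*(n)) ~ Q₂(n)`. -/
def IsHStar (h : ℕ → ℕ) : Prop :=
  Asymp (fun n : ℕ => S.α1 * S.A21 / (1 - S.α1) * (h n : ℝ) * S.Q1 (h n)) S.Q2

/-- `g*` is an integer-valued function with `Q₂(g*(n)) ~ Q₂₁(n)`. -/
def IsGStar (g : ℕ → ℕ) : Prop := Asymp (fun n => S.Q2 (g n)) S.Q21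

end GWSetup

/-- A critical iteration map `f` of regular variation index `1 + α` at `0`:  `f` and
`x ↦ x - f x` are nondecreasing on `[0, 1]`, `x ↦ (x - f x) / x` is nondecreasing on `(0, 1]`,
and `x - f x` is regularly varying at `0` with index `1 + α`. -/
structure CritMap (f : ℝ → ℝ) (α : ℝ) : Prop where
  pos : 0 < α
  zero : f 0 = 0
  mono : ∀ x y, 0 ≤ x → x ≤ y → y ≤ 1 → f x ≤ f y
  sub_mono : ∀ x y, 0 ≤ x → x ≤ y → y ≤ 1 → x - f x ≤ y - f y
  ratio_mono : ∀ x y, 0 < x → x ≤ y → y ≤ 1 → (x - f x) / x ≤ (y - f y) / y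
  regvar : ∀ c, 0 < c →
    Tendsto (fun x => (c * x - f (c * x)) / (x - f x)) (𝓝[>] 0) (𝓝 (c ^ (1 + α)))

/-- The time the flow `x' = -(x - f x)` needs to descend from `1` to `x`. -/
noncomputable def hitTime (f : ℝ → ℝ) (x : ℝ) : ℝ := ∫ y in x..1, 1 / (y - f y)

namespace CritMap

variable {f g : ℝ → ℝ} {α β κ : ℝ} {hs : ℕ → ℕ}

lemma eventually_mem_Ioc {b : ℝ} (hb : 0 < b) : ∀ᶠ x : ℝ in 𝓝[>] 0, 0 < x ∧ x ≤ b := by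
  filter_upwards [Ioc_mem_nhdsGT hb] with x hx using hx

lemma le_self (h : CritMap f α) {x : ℝ} (h0 : 0 ≤ x) (h1 : x ≤ 1) : f x ≤ x := by
  have := h.sub_mono 0 x le_rfl h0 h1
  rw [h.zero] at this; linarith

lemma sub_pos (h : CritMap f α) {x : ℝ} (h0 : 0 < x) (h1 : x ≤ 1) : 0 < x - f x := by
  have h2 := (h.regvar 1 one_pos).eventually_const_lt (show (0 : ℝ) < 1 ^ (1 + α) by simp)
  obtain ⟨y, hy, hy0, hyx⟩ := (h2.and (eventually_mem_Ioc h0)).exists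
  have h3 : y - f y ≠ 0 := by
    intro h4; simp [h4] at hy
  have h5 : f y ≤ y := h.le_self hy0.le (hyx.trans h1)
  have h6 := h.sub_mono y x hy0.le hyx h1
  have : 0 < y - f y := lt_of_le_of_ne (by linarith) (Ne.symm h3)
  linarith

lemma tendsto_ratio (h : CritMap f α) : Tendsto (fun x => (x - f x) / x) (𝓝[>] 0) (𝓝 0) := by
  have hpos : ∀ x, 0 < x → x ≤ 1 → 0 < (x - f x) / x := fun x h0 h1 => div_pos (h.sub_pos h0 h1) h0
  -- choose a point after which halving contracts the ratio
  have hr : (1 / 2 : ℝ) ^ α < 1 := Real.rpow_lt_one (by norm_num) (by norm_num) h.pos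
  obtain ⟨r, hr1, hr2⟩ := exists_between hr
  have hr0 : 0 < r := lt_trans (Real.rpow_pos_of_pos (by norm_num) _) hr1
  have hlim : Tendsto (fun x => (((1 / 2) * x - f ((1 / 2) * x)) / ((1 / 2) * x)) / ((x - f x) / x))
      (𝓝[>] 0) (𝓝 ((1 / 2 : ℝ) ^ α)) := by
    have := (h.regvar (1 / 2) (by norm_num)).mul_const 2
    have e : (1 / 2 : ℝ) ^ (1 + α) * 2 = (1 / 2 : ℝ) ^ α := by
      rw [Real.rpow_add (by norm_num), Real.rpow_one]; ring
    rw [e] at this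
    refine this.congr' ?_
    filter_upwards [eventually_mem_Ioc one_pos] with x hx
    have := (h.sub_pos hx.1 hx.2).ne'
    have := hx.1.ne'
    field_simp
  have hev := (hlim.eventually_lt_const hr1).and (eventually_mem_Ioc one_pos)
  obtain ⟨δ, hδ, hδ'⟩ := mem_nhdsGT_iff_exists_Ioc_subset.1 hev
  have hδ0 : 0 < δ := hδ
  have hδ1 : δ ≤ 1 := (hδ' ⟨hδ0, le_rfl⟩).2.2
  have hstep : ∀ x, 0 < x → x ≤ δ →
      ((1 / 2) * x - f ((1 / 2) * x)) / ((1 / 2) * x) ≤ r * ((x - f x) / x) := by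
    intro x h0 h1
    have := (hδ' ⟨h0, h1⟩).1
    rw [div_lt_iff₀ (hpos x h0 (h1.trans hδ1))] at this
    exact this.le
  have hpow : ∀ k : ℕ, 0 < (1 / 2 : ℝ) ^ k * δ ∧ (1 / 2 : ℝ) ^ k * δ ≤ δ ∧
      ((1 / 2 : ℝ) ^ k * δ - f ((1 / 2 : ℝ) ^ k * δ)) / ((1 / 2 : ℝ) ^ k * δ) ≤
        r ^ k * ((δ - f δ) / δ) := by
    intro k
    induction k with
    | zero => simp [hδ0]
    | succ k ih =>
      obtain ⟨i1, i2, i3⟩ := ih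
      have e : (1 / 2 : ℝ) ^ (k + 1) * δ = (1 / 2) * ((1 / 2 : ℝ) ^ k * δ) := by ring
      rw [e]
      refine ⟨by positivity, by linarith, (hstep _ i1 i2).trans ?_⟩
      calc r * _ ≤ r * (r ^ k * ((δ - f δ) / δ)) := by gcongr
        _ = _ := by ring
  have hgeo : Tendsto (fun k : ℕ => r ^ k * ((δ - f δ) / δ)) atTop (𝓝 0) := by
    simpa using (tendsto_pow_atTop_nhds_zero_of_lt_one hr0.le hr2).mul_const ((δ - f δ) / δ)
  refine tendsto_order.2 ⟨fun a ha => ?_, fun a ha => ?_⟩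
  · filter_upwards [eventually_mem_Ioc one_pos] with x hx using ha.trans (hpos x hx.1 hx.2)
  · obtain ⟨k, hk⟩ := (hgeo.eventually_lt_const ha).exists
    filter_upwards [eventually_mem_Ioc (hpow k).1] with x hx
    exact ((h.ratio_mono x _ hx.1 hx.2 ((hpow k).2.1.trans hδ1)).trans (hpow k).2.2).trans_lt hk

lemma tendsto_div_self (h : CritMap f α) : Tendsto (fun x => f x / x) (𝓝[>] 0) (𝓝 1) := by
  have := (tendsto_const_nhds (x := (1 : ℝ))).sub h.tendsto_ratio
  rw [sub_zero] at this
  refine this.congr' ?_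
  filter_upwards [eventually_mem_Ioc one_pos] with x hx
  have := hx.1.ne'
  field_simp; ring

lemma map_pos (h : CritMap f α) {x : ℝ} (h0 : 0 < x) (h1 : x ≤ 1) : 0 < f x := by
  obtain ⟨y, hy, hy0, hyx⟩ :=
    ((h.tendsto_div_self.eventually_const_lt (show (0 : ℝ) < 1 by norm_num)).and
      (eventually_mem_Ioc h0)).exists
  have : 0 < f y := by
    have := mul_pos hy hy0
    rwa [div_mul_cancel₀ _ hy0.ne'] at this
  exact this.trans_le (h.mono y x hy0.le hyx h1)

lemma iterate_mem (h : CritMap f α) {x : ℝ} (h0 : 0 < x) (h1 : x ≤ 1) (k : ℕ) :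
    0 < f^[k] x ∧ f^[k] x ≤ x := by
  induction k with
  | zero => simp [h0]
  | succ k ih =>
    rw [Function.iterate_succ_apply']
    exact ⟨h.map_pos ih.1 (ih.2.trans h1), (h.le_self ih.1.le (ih.2.trans h1)).trans ih.2⟩

lemma iterate_mono (h : CritMap f α) {x y : ℝ} (h0 : 0 < x) (hxy : x ≤ y) (h1 : y ≤ 1) (k : ℕ) :
    f^[k] x ≤ f^[k] y := by
  induction k with
  | zero => simpa
  | succ k ih =>
    rw [Function.iterate_succ_apply', Function.iterate_succ_apply']
    exact h.mono _ _ (h.iterate_mem h0 (hxy.trans h1) k).1.le ih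
      ((h.iterate_mem (h0.trans_le hxy) h1 k).2.trans h1)

lemma iterate_anti (h : CritMap f α) {x : ℝ} (h0 : 0 < x) (h1 : x ≤ 1) {k l : ℕ} (hkl : k ≤ l) :
    f^[l] x ≤ f^[k] x := by
  obtain ⟨j, rfl⟩ := Nat.exists_eq_add_of_le' hkl
  rw [Function.iterate_add_apply]
  have := h.iterate_mem h0 h1 k
  exact (h.iterate_mem this.1 (this.2.trans h1) j).2

lemma iterate_sub_le (h : CritMap f α) {x y : ℝ} (h0 : 0 < x) (hxy : x ≤ y) (h1 : y ≤ 1) (k : ℕ) :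
    f^[k] y - f^[k] x ≤ y - x := by
  induction k with
  | zero => simp
  | succ k ih =>
    rw [Function.iterate_succ_apply', Function.iterate_succ_apply']
    have := h.sub_mono _ _ (h.iterate_mem h0 (hxy.trans h1) k).1.le (h.iterate_mono h0 hxy h1 k)
      ((h.iterate_mem (h0.trans_le hxy) h1 k).2.trans h1)
    linarith

lemma antitoneOn_inv (h : CritMap f α) {a b : ℝ} (ha : 0 < a) (hb : b ≤ 1) :
    AntitoneOn (fun y => 1 / (y - f y)) (Set.Icc a b) := by
  intro x hx y hy hxy
  exact one_div_le_one_div_of_le (h.sub_pos (ha.trans_le hx.1) (hx.2.trans hb))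
    (h.sub_mono x y (ha.le.trans hx.1) hxy (hy.2.trans hb))

lemma intervalIntegrable_inv (h : CritMap f α) {a b : ℝ} (ha : 0 < a) (hab : a ≤ b) (hb : b ≤ 1) :
    IntervalIntegrable (fun y => 1 / (y - f y)) volume a b := by
  apply AntitoneOn.intervalIntegrable
  rw [Set.uIcc_of_le hab]
  exact h.antitoneOn_inv ha hb

lemma hitTime_sub (h : CritMap f α) {a b : ℝ} (ha : 0 < a) (hab : a ≤ b) (hb : b ≤ 1) :
    hitTime f a - hitTime f b = ∫ y in a..b, 1 / (y - f y) := by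
  unfold hitTime
  rw [sub_eq_iff_eq_add, intervalIntegral.integral_add_adjacent_intervals]
  · exact h.intervalIntegrable_inv ha hab hb
  · exact h.intervalIntegrable_inv (ha.trans_le hab) hb le_rfl

lemma hitTime_sub_ge (h : CritMap f α) {a b : ℝ} (ha : 0 < a) (hab : a ≤ b) (hb : b ≤ 1) :
    (b - a) / (b - f b) ≤ hitTime f a - hitTime f b := by
  rw [h.hitTime_sub ha hab hb]
  have := intervalIntegral.integral_mono_on hab (intervalIntegrable_const (c := 1 / (b - f b)))
    (h.intervalIntegrable_inv ha hab hb)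
    (fun x hx => h.antitoneOn_inv ha hb hx ⟨hab, le_rfl⟩ hx.2)
  simpa [div_eq_mul_inv] using this

lemma hitTime_sub_le (h : CritMap f α) {a b : ℝ} (ha : 0 < a) (hab : a ≤ b) (hb : b ≤ 1) :
    hitTime f a - hitTime f b ≤ (b - a) / (a - f a) := by
  rw [h.hitTime_sub ha hab hb]
  have := intervalIntegral.integral_mono_on hab (h.intervalIntegrable_inv ha hab hb)
    (intervalIntegrable_const (c := 1 / (a - f a)))
    (fun x hx => h.antitoneOn_inv ha hb ⟨le_rfl, hab⟩ hx hx.1)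
  simpa [div_eq_mul_inv] using this

lemma hitTime_anti (h : CritMap f α) {a b : ℝ} (ha : 0 < a) (hab : a ≤ b) (hb : b ≤ 1) :
    hitTime f b ≤ hitTime f a := by
  have h1 := h.hitTime_sub_ge ha hab hb
  have h2 : 0 ≤ (b - a) / (b - f b) :=
    div_nonneg (by linarith) (h.sub_pos (ha.trans_le hab) hb).le
  linarith

lemma hitTime_one : hitTime f 1 = 0 := by simp [hitTime]

lemma hitTime_nonneg (h : CritMap f α) {a : ℝ} (ha : 0 < a) (ha1 : a ≤ 1) : 0 ≤ hitTime f a := by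
  rw [← hitTime_one (f := f)]; exact h.hitTime_anti ha ha1 le_rfl

lemma hitTime_map_ge (h : CritMap f α) {x : ℝ} (h0 : 0 < x) (h1 : x ≤ 1) :
    1 ≤ hitTime f (f x) - hitTime f x := by
  have := h.hitTime_sub_ge (h.map_pos h0 h1) (h.le_self h0.le h1) h1
  rwa [div_self (h.sub_pos h0 h1).ne'] at this

lemma hitTime_iterate_ge (h : CritMap f α) {x : ℝ} (h0 : 0 < x) (h1 : x ≤ 1) (k : ℕ) :
    hitTime f x + k ≤ hitTime f (f^[k] x) := by
  induction k with
  | zero => simp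
  | succ k ih =>
    rw [Function.iterate_succ_apply']
    have hm := h.iterate_mem h0 h1 k
    have := h.hitTime_map_ge hm.1 (hm.2.trans h1)
    push_cast; linarith

lemma tendsto_hitTime (h : CritMap f α) : Tendsto (hitTime f) (𝓝[>] 0) atTop := by
  refine tendsto_atTop.2 fun b => ?_
  obtain ⟨k, hk⟩ := exists_nat_ge b
  have hm := h.iterate_mem one_pos le_rfl k
  filter_upwards [eventually_mem_Ioc hm.1] with x hx
  have h1 := h.hitTime_iterate_ge one_pos le_rfl k
  rw [hitTime_one] at h1
  have h2 := h.hitTime_anti hx.1 hx.2 hm.2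
  linarith

lemma tendsto_sub_map_div (h : CritMap f α) :
    Tendsto (fun x => (f x - f (f x)) / (x - f x)) (𝓝[>] 0) (𝓝 1) := by
  refine tendsto_order.2 ⟨fun a ha => ?_, fun a ha => ?_⟩
  · -- compare with `φ (r x) / φ x` for some `r < 1` close to `1`
    have hc : Tendsto (fun r : ℝ => r ^ (1 + α)) (𝓝[<] 1) (𝓝 1) := by
      have := (Real.continuousAt_rpow_const 1 (1 + α) (Or.inl one_ne_zero)).tendsto
      rw [Real.one_rpow] at this
      exact this.mono_left nhdsWithin_le_nhds
    obtain ⟨r, hr, hr0, hr1⟩ := ((hc.eventually_const_lt ha).and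
      (Ioo_mem_nhdsLT (show (0 : ℝ) < 1 by norm_num))).exists
    filter_upwards [(h.regvar r hr0).eventually_const_lt hr,
      h.tendsto_div_self.eventually_const_lt hr1, eventually_mem_Ioc one_pos] with x hx1 hx2 hx
    refine hx1.trans_le ?_
    have hp := h.sub_pos hx.1 hx.2
    have hrx : r * x ≤ f x := by rw [lt_div_iff₀ hx.1] at hx2; exact hx2.le
    have := h.sub_mono (r * x) (f x) (mul_nonneg hr0.le hx.1.le) hrx
      ((h.le_self hx.1.le hx.2).trans hx.2)
    gcongr
  · filter_upwards [eventually_mem_Ioc one_pos] with x hx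
    refine lt_of_le_of_lt ?_ ha
    rw [div_le_one (h.sub_pos hx.1 hx.2)]
    exact h.sub_mono _ _ (h.map_pos hx.1 hx.2).le (h.le_self hx.1.le hx.2) hx.2

lemma tendsto_hitTime_map_sub (h : CritMap f α) :
    Tendsto (fun x => hitTime f (f x) - hitTime f x) (𝓝[>] 0) (𝓝 1) := by
  have hu : Tendsto (fun x => ((f x - f (f x)) / (x - f x))⁻¹) (𝓝[>] 0) (𝓝 1) := by
    simpa using h.tendsto_sub_map_div.inv₀ one_ne_zero
  refine tendsto_of_tendsto_of_tendsto_of_le_of_le' tendsto_const_nhds hu ?_ ?_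
  · filter_upwards [eventually_mem_Ioc one_pos] with x hx using h.hitTime_map_ge hx.1 hx.2
  · filter_upwards [eventually_mem_Ioc one_pos] with x hx
    rw [inv_div]
    exact h.hitTime_sub_le (h.map_pos hx.1 hx.2) (h.le_self hx.1.le hx.2) hx.2

lemma exists_hitTime_iterate_le (h : CritMap f α) {ε : ℝ} (hε : 0 < ε) :
    ∃ δ, 0 < δ ∧ δ ≤ 1 ∧ ∀ x, 0 < x → x ≤ δ → ∀ k : ℕ,
      hitTime f (f^[k] x) ≤ hitTime f x + (1 + ε) * k := by
  have hev := (h.tendsto_hitTime_map_sub.eventually_lt_const (show 1 < 1 + ε by linarith)).and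
    (eventually_mem_Ioc one_pos)
  obtain ⟨δ, hδ, hδ'⟩ := mem_nhdsGT_iff_exists_Ioc_subset.1 hev
  have hδ0 : 0 < δ := hδ
  have hδ1 : δ ≤ 1 := (hδ' ⟨hδ0, le_rfl⟩).2.2
  refine ⟨δ, hδ0, hδ1, fun x h0 h1 k => ?_⟩
  induction k with
  | zero => simp
  | succ k ih =>
    rw [Function.iterate_succ_apply']
    have hm := h.iterate_mem h0 (h1.trans hδ1) k
    have := (hδ' ⟨hm.1, hm.2.trans h1⟩).1
    push_cast
    linarith

lemma tendsto_hitTime_mul_div (h : CritMap f α) {c : ℝ} (hc : 0 < c) :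
    Tendsto (fun x => hitTime f (c * x) / hitTime f x) (𝓝[>] 0) (𝓝 (c ^ (-α))) := by
  have hlim : Tendsto (fun x => c * ((x - f x) / (c * x - f (c * x)))) (𝓝[>] 0) (𝓝 (c ^ (-α))) := by
    have := ((h.regvar c hc).inv₀ (Real.rpow_pos_of_pos hc _).ne').const_mul c
    have e : c * (c ^ (1 + α))⁻¹ = c ^ (-α) := by
      rw [Real.rpow_add hc, Real.rpow_one, Real.rpow_neg hc.le]; field_simp
    rw [e] at this
    simpa [inv_div] using this
  have hΦ := h.tendsto_hitTime
  -- integral comparison on `[x, δ]`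
  have key : ∀ a b : ℝ, a < c ^ (-α) → c ^ (-α) < b → ∃ δ, 0 < δ ∧ δ ≤ 1 ∧ c * δ ≤ 1 ∧
      ∀ x, 0 < x → x ≤ δ →
        a * (hitTime f x - hitTime f δ) ≤ hitTime f (c * x) - hitTime f (c * δ) ∧
        hitTime f (c * x) - hitTime f (c * δ) ≤ b * (hitTime f x - hitTime f δ) := by
    intro a b ha hb
    have hev := ((hlim.eventually_const_lt ha).and (hlim.eventually_lt_const hb)).and
      (eventually_mem_Ioc (lt_min one_pos (inv_pos.2 hc)))
    obtain ⟨δ, hδ, hδ'⟩ := mem_nhdsGT_iff_exists_Ioc_subset.1 hev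
    have hδ0 : 0 < δ := hδ
    have hδm : δ ≤ min 1 c⁻¹ := (hδ' ⟨hδ0, le_rfl⟩).2.2
    have hδ1 : δ ≤ 1 := hδm.trans (min_le_left _ _)
    have hcδ : c * δ ≤ 1 := by
      have := mul_le_mul_of_nonneg_left (hδm.trans (min_le_right _ _)) hc.le
      rwa [mul_inv_cancel₀ hc.ne'] at this
    refine ⟨δ, hδ0, hδ1, hcδ, fun x h0 h1 => ?_⟩
    have hcx : c * x ≤ c * δ := mul_le_mul_of_nonneg_left h1 hc.le
    have e1 : hitTime f (c * x) - hitTime f (c * δ) =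
        ∫ y in x..δ, c * (1 / (c * y - f (c * y))) := by
      rw [h.hitTime_sub (mul_pos hc h0) hcx hcδ, intervalIntegral.integral_const_mul]
      exact (intervalIntegral.mul_integral_comp_mul_left (f := fun y => 1 / (y - f y)) c).symm
    have i1 : IntervalIntegrable (fun y => c * (1 / (c * y - f (c * y)))) volume x δ := by
      have : AntitoneOn (fun y => c * (1 / (c * y - f (c * y)))) (Set.uIcc x δ) := by
        rw [Set.uIcc_of_le h1]
        intro y hy z hz hyz
        have := h.antitoneOn_inv (mul_pos hc h0) hcδ
          (show c * y ∈ Set.Icc (c * x) (c * δ) from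
            ⟨mul_le_mul_of_nonneg_left hy.1 hc.le, mul_le_mul_of_nonneg_left hy.2 hc.le⟩)
          (show c * z ∈ Set.Icc (c * x) (c * δ) from
            ⟨mul_le_mul_of_nonneg_left hz.1 hc.le, mul_le_mul_of_nonneg_left hz.2 hc.le⟩)
          (mul_le_mul_of_nonneg_left hyz hc.le)
        exact mul_le_mul_of_nonneg_left this hc.le
      exact this.intervalIntegrable
    have i2 := h.intervalIntegrable_inv h0 h1 hδ1
    have hpt : ∀ y ∈ Set.Icc x δ, a * (1 / (y - f y)) ≤ c * (1 / (c * y - f (c * y))) ∧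
        c * (1 / (c * y - f (c * y))) ≤ b * (1 / (y - f y)) := by
      intro y hy
      have hy0 := h0.trans_le hy.1
      have hp := h.sub_pos hy0 (hy.2.trans hδ1)
      obtain ⟨⟨q1, q2⟩, -⟩ := hδ' ⟨hy0, hy.2⟩
      have e : c * ((y - f y) / (c * y - f (c * y))) =
          c * (1 / (c * y - f (c * y))) * (y - f y) := by
        ring
      rw [e] at q1 q2
      rw [mul_one_div a, mul_one_div b, div_le_iff₀ hp, le_div_iff₀ hp]
      exact ⟨q1.le, q2.le⟩
    rw [e1, h.hitTime_sub h0 h1 hδ1, ← intervalIntegral.integral_const_mul,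
      ← intervalIntegral.integral_const_mul]
    exact ⟨intervalIntegral.integral_mono_on h1 (i2.const_mul a) i1 fun y hy => (hpt y hy).1,
      intervalIntegral.integral_mono_on h1 i1 (i2.const_mul b) fun y hy => (hpt y hy).2⟩
  have haff : ∀ p q r : ℝ,
      Tendsto (fun x => (p * (hitTime f x - q) + r) / hitTime f x) (𝓝[>] 0) (𝓝 p) := by
    intro p q r
    have h1 : Tendsto (fun x => p + (r - p * q) / hitTime f x) (𝓝[>] 0) (𝓝 (p + 0)) :=
      tendsto_const_nhds.add (hΦ.const_div_atTop _)
    rw [add_zero] at h1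
    refine h1.congr' ?_
    filter_upwards [hΦ.eventually_gt_atTop 0] with x hx
    field_simp; ring
  refine tendsto_order.2 ⟨fun a ha => ?_, fun b hb => ?_⟩
  · obtain ⟨a', ha1, ha2⟩ := exists_between ha
    obtain ⟨δ, hδ0, hδ1, hcδ, H⟩ := key a' (c ^ (-α) + 1) ha2 (by linarith)
    filter_upwards [(haff a' (hitTime f δ) (hitTime f (c * δ))).eventually_const_lt ha1,
      eventually_mem_Ioc hδ0, hΦ.eventually_gt_atTop 0] with x h1 h2 h3
    refine h1.trans_le ?_
    have := (H x h2.1 h2.2).1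
    gcongr; linarith
  · obtain ⟨b', hb1, hb2⟩ := exists_between hb
    obtain ⟨δ, hδ0, hδ1, hcδ, H⟩ := key (c ^ (-α) - 1) b' (by linarith) hb1
    filter_upwards [(haff b' (hitTime f δ) (hitTime f (c * δ))).eventually_lt_const hb2,
      eventually_mem_Ioc hδ0, hΦ.eventually_gt_atTop 0] with x h1 h2 h3
    refine lt_of_le_of_lt ?_ h1
    have := (H x h2.1 h2.2).2
    gcongr; linarith

lemma tendsto_sub_mul_hitTime_div (h : CritMap f α) :
    Tendsto (fun x => (x - f x) * hitTime f x / x) (𝓝[>] 0) (𝓝 (1 / α)) := by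
  have hΦ := h.tendsto_hitTime
  have hder : Tendsto (fun c : ℝ => (c ^ (-α) - 1) / (1 - c)) (𝓝[≠] 1) (𝓝 α) := by
    have h1 := (Real.hasDerivAt_rpow_const (x := 1) (p := -α) (Or.inl one_ne_zero))
    rw [hasDerivAt_iff_tendsto_slope] at h1
    have h2 := h1.neg
    simp only [Real.one_rpow, mul_one, neg_neg] at h2
    refine h2.congr fun c => ?_
    rw [slope_def_field, Real.one_rpow, ← div_neg, neg_sub]
  have hderR : Tendsto (fun c : ℝ => (c ^ (-α) - 1) / (1 - c)) (𝓝[>] 1) (𝓝 α) :=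
    hder.mono_left (nhdsWithin_mono _ fun x (hx : 1 < x) => hx.ne')
  have hderL : Tendsto (fun c : ℝ => (c ^ (-α) - 1) / (1 - c)) (𝓝[<] 1) (𝓝 α) :=
    hder.mono_left (nhdsWithin_mono _ fun x (hx : x < 1) => hx.ne)
  suffices H : Tendsto (fun x => x / ((x - f x) * hitTime f x)) (𝓝[>] 0) (𝓝 α) by
    have := H.inv₀ h.pos.ne'
    simpa [inv_div] using this
  have hq : ∀ c : ℝ, 0 < c → Tendsto (fun x => (hitTime f (c * x) / hitTime f x - 1) / (1 - c))
      (𝓝[>] 0) (𝓝 ((c ^ (-α) - 1) / (1 - c))) := fun c hc =>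
    ((h.tendsto_hitTime_mul_div hc).sub_const 1).div_const _
  refine tendsto_order.2 ⟨fun a ha => ?_, fun b hb => ?_⟩
  · obtain ⟨c, hc, hc1⟩ := ((hderR.eventually_const_lt ha).and
      (self_mem_nhdsWithin (s := Set.Ioi (1 : ℝ)))).exists
    have hc1 : 1 < c := hc1
    have hc0 : 0 < c := by linarith
    filter_upwards [(hq c hc0).eventually_const_lt hc, eventually_mem_Ioc one_pos,
      eventually_mem_Ioc (inv_pos.2 hc0), hΦ.eventually_gt_atTop 0] with x h1 h2 h3 h4
    refine h1.trans_le ?_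
    have hp := h.sub_pos h2.1 h2.2
    have hcx : c * x ≤ 1 := by
      have := mul_le_mul_of_nonneg_left h3.2 hc0.le
      rwa [mul_inv_cancel₀ hc0.ne'] at this
    have h5 := h.hitTime_sub_le h2.1 (by nlinarith : x ≤ c * x) hcx
    have e : (hitTime f (c * x) / hitTime f x - 1) / (1 - c) =
      (hitTime f x - hitTime f (c * x)) / ((c - 1) * hitTime f x) := by
      have : 1 - c ≠ 0 := by linarith
      have : c - 1 ≠ 0 := by linarith
      field_simp; ring
    rw [e, div_le_div_iff₀ (mul_pos (by linarith) h4) (mul_pos hp h4)]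
    rw [le_div_iff₀ hp] at h5
    nlinarith
  · obtain ⟨c, hc, hc0, hc1⟩ := ((hderL.eventually_lt_const hb).and
      (Ioo_mem_nhdsLT (show (0 : ℝ) < 1 by norm_num))).exists
    filter_upwards [(hq c hc0).eventually_lt_const hc, eventually_mem_Ioc one_pos,
      hΦ.eventually_gt_atTop 0] with x h1 h2 h4
    refine lt_of_le_of_lt ?_ h1
    have hp := h.sub_pos h2.1 h2.2
    have h5 := h.hitTime_sub_ge (mul_pos hc0 h2.1) (by nlinarith [h2.1] : c * x ≤ x) h2.2
    have e : (hitTime f (c * x) / hitTime f x - 1) / (1 - c) =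
      (hitTime f (c * x) - hitTime f x) / ((1 - c) * hitTime f x) := by
      have : 1 - c ≠ 0 := by linarith
      field_simp
    rw [e, div_le_div_iff₀ (mul_pos hp h4) (mul_pos (by linarith) h4)]
    rw [div_le_iff₀ hp] at h5
    nlinarith

/-- The decrements of `x * hitTime f x` along the iteration are asymptotically proportional
to `x`. -/
lemma tendsto_mul_hitTime_decrement (h : CritMap f α) :
    Tendsto (fun x => (x * hitTime f x - f x * hitTime f (f x)) / x) (𝓝[>] 0)
      (𝓝 (1 / α - 1)) := by
  have h1 := h.tendsto_sub_mul_hitTime_div.sub (h.tendsto_div_self.mul h.tendsto_hitTime_map_sub)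
  rw [one_mul] at h1
  refine h1.congr fun x => ?_
  ring

section sequences

variable {ι : Type*} {l : Filter ι}

lemma tendsto_hitTime_div (h : CritMap f α) {x y : ι → ℝ} {c : ℝ} (hc : 0 < c)
    (hx : Tendsto x l (𝓝[>] 0)) (hy : Tendsto y l (𝓝[>] 0))
    (hxy : Tendsto (fun n => x n / y n) l (𝓝 c)) :
    Tendsto (fun n => hitTime f (x n) / hitTime f (y n)) l (𝓝 (c ^ (-α))) := by
  have hcont : Tendsto (fun r : ℝ => r ^ (-α)) (𝓝 c) (𝓝 (c ^ (-α))) :=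
    (Real.continuousAt_rpow_const c (-α) (Or.inl hc.ne')).tendsto
  have hx' := hx.eventually (eventually_mem_Ioc one_pos)
  have hΦ := h.tendsto_hitTime.comp hy
  refine tendsto_order.2 ⟨fun a ha => ?_, fun b hb => ?_⟩
  · obtain ⟨r, hr, hcr⟩ := (((hcont.mono_left nhdsWithin_le_nhds).eventually_const_lt ha).and
      (self_mem_nhdsWithin (s := Set.Ioi c))).exists
    have hcr : c < r := hcr
    have hr0 : 0 < r := hc.trans hcr
    filter_upwards [hx', hy.eventually (eventually_mem_Ioc (inv_pos.2 hr0)),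
      ((h.tendsto_hitTime_mul_div hr0).comp hy).eventually_const_lt hr,
      hxy.eventually_lt_const hcr, hΦ.eventually_gt_atTop 0] with n h1 h2 h3 h4 h5
    refine lt_of_lt_of_le h3 ?_
    have hry : r * y n ≤ 1 := by
      have := mul_le_mul_of_nonneg_left h2.2 hr0.le
      rwa [mul_inv_cancel₀ hr0.ne'] at this
    rw [div_lt_iff₀ h2.1] at h4
    have := h.hitTime_anti h1.1 h4.le hry
    simp only [Function.comp] at h5 ⊢
    gcongr
  · obtain ⟨r, hr, hr0, hcr⟩ := (((hcont.mono_left nhdsWithin_le_nhds).eventually_lt_const hb).and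
      (Ioo_mem_nhdsLT hc)).exists
    filter_upwards [hx', hy.eventually (eventually_mem_Ioc one_pos),
      ((h.tendsto_hitTime_mul_div hr0).comp hy).eventually_lt_const hr,
      hxy.eventually_const_lt hcr, hΦ.eventually_gt_atTop 0] with n h1 h2 h3 h4 h5
    refine lt_of_le_of_lt ?_ h3
    rw [lt_div_iff₀ h2.1] at h4
    have := h.hitTime_anti (mul_pos hr0 h2.1) h4.le h1.2
    simp only [Function.comp] at h5 ⊢
    gcongr

lemma tendsto_div_of_hitTime (h : CritMap f α) {x y : ι → ℝ} {c : ℝ} (hc : 0 < c)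
    (hx : Tendsto x l (𝓝[>] 0)) (hy : Tendsto y l (𝓝[>] 0))
    (hxy : Tendsto (fun n => hitTime f (x n) / hitTime f (y n)) l (𝓝 c)) :
    Tendsto (fun n => x n / y n) l (𝓝 (c ^ (-1 / α))) := by
  have hα := h.pos
  have hx' := hx.eventually (eventually_mem_Ioc one_pos)
  have hΦ := h.tendsto_hitTime.comp hy
  have hcpos : 0 < c ^ (-1 / α) := Real.rpow_pos_of_pos hc _
  have hback : (c ^ (-1 / α)) ^ (-α) = c := by
    rw [← Real.rpow_mul hc.le]
    have : -1 / α * -α = 1 := by field_simp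
    rw [this, Real.rpow_one]
  refine tendsto_order.2 ⟨fun a ha => ?_, fun b hb => ?_⟩
  · rcases le_or_gt a 0 with ha0 | ha0
    · filter_upwards [hx', hy.eventually (eventually_mem_Ioc one_pos)] with n h1 h2
      exact ha0.trans_lt (div_pos h1.1 h2.1)
    have hlt : c < a ^ (-α) := by
      rw [← hback]; exact Real.rpow_lt_rpow_of_neg ha0 ha (by linarith)
    obtain ⟨r, hr1, hr2⟩ := exists_between hlt
    filter_upwards [hx', hy.eventually (eventually_mem_Ioc (inv_pos.2 ha0)),
      ((h.tendsto_hitTime_mul_div ha0).comp hy).eventually_const_lt hr2,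
      hxy.eventually_lt_const hr1, hΦ.eventually_gt_atTop 0] with n h1 h2 h3 h4 h5
    by_contra hcon
    rw [not_lt, div_le_iff₀ h2.1] at hcon
    have hay : a * y n ≤ 1 := by
      have := mul_le_mul_of_nonneg_left h2.2 ha0.le
      rwa [mul_inv_cancel₀ ha0.ne'] at this
    have := h.hitTime_anti h1.1 hcon hay
    simp only [Function.comp] at h3 h5
    have : hitTime f (a * y n) / hitTime f (y n) ≤ hitTime f (x n) / hitTime f (y n) := by gcongr
    linarith
  · have hb0 : 0 < b := hcpos.trans hb
    have hlt : b ^ (-α) < c := by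
      conv_rhs => rw [← hback]
      exact Real.rpow_lt_rpow_of_neg hcpos hb (by linarith)
    obtain ⟨r, hr1, hr2⟩ := exists_between hlt
    filter_upwards [hx', hy.eventually (eventually_mem_Ioc one_pos),
      ((h.tendsto_hitTime_mul_div hb0).comp hy).eventually_lt_const hr1,
      hxy.eventually_const_lt hr2, hΦ.eventually_gt_atTop 0] with n h1 h2 h3 h4 h5
    by_contra hcon
    rw [not_lt, le_div_iff₀ h2.1] at hcon
    have := h.hitTime_anti (mul_pos hb0 h2.1) hcon h1.2
    simp only [Function.comp] at h3 h5
    have : hitTime f (x n) / hitTime f (y n) ≤ hitTime f (b * y n) / hitTime f (y n) := by gcongr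
    linarith

lemma tendsto_hitTime_iterate_div (h : CritMap f α) {x : ι → ℝ} {k : ι → ℕ} {N : ι → ℝ} {a b : ℝ}
    (hx : Tendsto x l (𝓝[>] 0)) (hN : ∀ᶠ n in l, 0 < N n)
    (ha : Tendsto (fun n => hitTime f (x n) / N n) l (𝓝 a))
    (hb : Tendsto (fun n => k n / N n) l (𝓝 b)) :
    Tendsto (fun n => hitTime f (f^[k n] (x n)) / N n) l (𝓝 (a + b)) := by
  have h0 := ha.add hb
  refine tendsto_order.2 ⟨fun p hp => ?_, fun p hp => ?_⟩
  · filter_upwards [h0.eventually_const_lt hp, hx.eventually (eventually_mem_Ioc one_pos), hN]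
      with n h1 h2 h3
    refine h1.trans_le ?_
    rw [← add_div]
    have := h.hitTime_iterate_ge h2.1 h2.2 (k n)
    gcongr
  · have hc : Tendsto (fun ε : ℝ => a + (1 + ε) * b) (𝓝[>] 0) (𝓝 (a + b)) := by
      have : Continuous (fun ε : ℝ => a + (1 + ε) * b) := by fun_prop
      have := this.tendsto 0
      simp only [add_zero, one_mul] at this
      exact this.mono_left nhdsWithin_le_nhds
    obtain ⟨ε, hε, hε0⟩ := ((hc.eventually_lt_const hp).and
      (self_mem_nhdsWithin (s := Set.Ioi (0 : ℝ)))).exists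
    obtain ⟨δ, hδ0, hδ1, H⟩ := h.exists_hitTime_iterate_le (show 0 < ε from hε0)
    filter_upwards [(ha.add (hb.const_mul (1 + ε))).eventually_lt_const hε,
      hx.eventually (eventually_mem_Ioc hδ0), hN] with n h1 h2 h3
    refine lt_of_le_of_lt ?_ h1
    have := H _ h2.1 h2.2 (k n)
    rw [← mul_div_assoc, ← add_div]
    gcongr

end sequences

lemma tendsto_iterate_one (h : CritMap f α) : Tendsto (fun n => f^[n] 1) atTop (𝓝[>] 0) := by
  refine tendsto_nhdsWithin_iff.2 ⟨?_, Eventually.of_forall fun n =>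
    (h.iterate_mem one_pos le_rfl n).1⟩
  refine tendsto_order.2 ⟨fun a ha => ?_, fun a ha => ?_⟩
  · exact Eventually.of_forall fun n => ha.trans (h.iterate_mem one_pos le_rfl n).1
  · have hm : 0 < min a 1 := lt_min ha one_pos
    filter_upwards [(tendsto_natCast_atTop_atTop (R := ℝ)).eventually_gt_atTop
      (hitTime f (min a 1))] with n hn
    by_contra hcon
    rw [not_lt] at hcon
    have h1 := h.hitTime_anti hm ((min_le_left a 1).trans hcon) (h.iterate_mem one_pos le_rfl n).2
    have h2 := h.hitTime_iterate_ge one_pos le_rfl n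
    rw [hitTime_one] at h2
    linarith

lemma tendsto_hitTime_iterate_one_div (h : CritMap f α) :
    Tendsto (fun n : ℕ => hitTime f (f^[n] 1) / n) atTop (𝓝 1) := by
  have h1 := (h.tendsto_hitTime_map_sub.comp h.tendsto_iterate_one).cesaro
  refine h1.congr fun n => ?_
  have : ∀ i, ((fun x => hitTime f (f x) - hitTime f x) ∘ fun n => f^[n] 1) i =
      hitTime f (f^[i + 1] 1) - hitTime f (f^[i] 1) := by
    intro i; simp [Function.iterate_succ_apply', -Function.iterate_succ]
  simp_rw [this]
  rw [Finset.sum_range_sub (fun i => hitTime f (f^[i] 1))]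
  simp [hitTime_one]
  ring

lemma tendsto_iterate_one_div (h : CritMap f α) {ι : Type*} {l : Filter ι} {a b : ι → ℕ} {c : ℝ}
    (hc : 0 < c) (ha : Tendsto a l atTop) (hb : Tendsto b l atTop)
    (hab : Tendsto (fun n => (a n : ℝ) / b n) l (𝓝 c)) :
    Tendsto (fun n => f^[a n] 1 / f^[b n] 1) l (𝓝 (c ^ (-1 / α))) := by
  refine h.tendsto_div_of_hitTime hc (h.tendsto_iterate_one.comp ha)
    (h.tendsto_iterate_one.comp hb) ?_
  have h1 := ((h.tendsto_hitTime_iterate_one_div.comp ha).mul hab).div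
    (h.tendsto_hitTime_iterate_one_div.comp hb) one_ne_zero
  rw [one_mul, div_one] at h1
  refine h1.congr' ?_
  filter_upwards [ha.eventually_gt_atTop 0, hb.eventually_gt_atTop 0] with n h1 h2
  have h1 : (a n : ℝ) ≠ 0 := by positivity
  have h2 : (b n : ℝ) ≠ 0 := by positivity
  simp only [Function.comp, Pi.div_apply]
  field_simp

/-- Immigration before time `K` moved to time `0` gives a lower bound. -/
lemma iterate_le_of_perturbed (h : CritMap g α) {v a : ℕ → ℝ} (hv0 : ∀ k, 0 ≤ v k)
    (hv1 : ∀ k, v k ≤ 1) (ha : ∀ k, 0 ≤ a k) (hrec : ∀ k, v (k + 1) = g (v k) + a k) {K m : ℕ}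
    (hKm : K ≤ m) (hpos : 0 < v 0 + ∑ k ∈ Finset.range K, a k)
    (hle : v 0 + ∑ k ∈ Finset.range K, a k ≤ 1) :
    g^[m] (v 0 + ∑ k ∈ Finset.range K, a k) ≤ v m := by
  have hSle : ∀ j, j ≤ K → v 0 + ∑ k ∈ Finset.range j, a k ≤ 1 := fun j hj => by
    refine le_trans ?_ hle
    have := Finset.sum_le_sum_of_subset_of_nonneg (f := a) (Finset.range_mono hj)
      (fun i _ _ => ha i)
    linarith
  have hzero : ∀ j, g^[j] 0 = 0 := fun j => Function.iterate_fixed h.zero j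
  have hS0 : ∀ j, 0 ≤ v 0 + ∑ k ∈ Finset.range j, a k := fun j =>
    add_nonneg (hv0 0) (Finset.sum_nonneg fun i _ => ha i)
  have it_mem : ∀ x, 0 ≤ x → x ≤ 1 → ∀ j, 0 ≤ g^[j] x ∧ g^[j] x ≤ x := by
    intro x hx0 hx1 j
    rcases hx0.eq_or_lt with rfl | hx0
    · simp [hzero]
    · exact ⟨(h.iterate_mem hx0 hx1 j).1.le, (h.iterate_mem hx0 hx1 j).2⟩
  have it_sub : ∀ x y, 0 ≤ x → x ≤ y → y ≤ 1 → ∀ j, g^[j] y - g^[j] x ≤ y - x := by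
    intro x y hx0 hxy hy1 j
    rcases hx0.eq_or_lt with rfl | hx0
    · have := (it_mem y hxy hy1 j).2
      rw [hzero]; linarith
    · exact h.iterate_sub_le hx0 hxy hy1 j
  have step : ∀ j, j ≤ K → g^[j] (v 0 + ∑ k ∈ Finset.range j, a k) ≤ v j := by
    intro j
    induction j with
    | zero => simp
    | succ j ih =>
      intro hj
      have ih := ih (by omega)
      have hSj := hSle j (by omega)
      have m1 := it_mem _ (hS0 j) hSj j
      have m2 := h.mono _ _ m1.1 ih (hv1 j)
      have hadd := Finset.sum_range_succ a j
      have m3 := it_sub (v 0 + ∑ k ∈ Finset.range j, a k) (v 0 + ∑ k ∈ Finset.range (j + 1), a k)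
        (hS0 j) (by rw [hadd]; linarith [ha j]) (hSle _ hj) (j + 1)
      rw [Function.iterate_succ_apply' g j (v 0 + ∑ k ∈ Finset.range j, a k), hadd] at m3
      rw [hrec, hadd]
      linarith
  obtain ⟨j, rfl⟩ := Nat.exists_eq_add_of_le hKm
  clear hKm
  induction j with
  | zero => exact step K le_rfl
  | succ j ih =>
    rw [← add_assoc, Function.iterate_succ_apply', hrec]
    have := h.mono _ _ (h.iterate_mem hpos hle (K + j)).1.le ih (hv1 _)
    linarith [ha (K + j)]

/-- Immigration before time `K` moved to time `K` and the later one moved to time `m` gives an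
upper bound. -/
lemma perturbed_le_iterate (h : CritMap g α) {v a : ℕ → ℝ} (hv0 : ∀ k, 0 ≤ v k)
    (hv1 : ∀ k, v k ≤ 1) (ha : ∀ k, 0 ≤ a k) (hrec : ∀ k, v (k + 1) = g (v k) + a k) {K m : ℕ}
    (hKm : K ≤ m) {w : ℝ} (hw0 : 0 < w) (hw1 : w ≤ 1) (hw : v K ≤ w) :
    v m ≤ g^[m - K] w + ∑ k ∈ Finset.Ico K m, a k := by
  obtain ⟨j, rfl⟩ := Nat.exists_eq_add_of_le hKm
  clear hKm
  rw [Nat.add_sub_cancel_left]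
  induction j with
  | zero => simpa
  | succ j ih =>
    rw [← add_assoc, Finset.sum_Ico_succ_top (by omega), Function.iterate_succ_apply', hrec]
    have hm := h.iterate_mem hw0 hw1 j
    have hR : 0 ≤ ∑ k ∈ Finset.Ico K (K + j), a k := Finset.sum_nonneg fun i _ => ha i
    rcases le_total (v (K + j)) (g^[j] w) with hc | hc
    · have := h.mono _ _ (hv0 _) hc (hm.2.trans hw1)
      linarith
    · have := h.sub_mono _ _ hm.1.le hc (hv1 _)
      linarith

lemma perturbed_le_sum (h : CritMap g α) {v a : ℕ → ℝ} (hv0 : ∀ k, 0 ≤ v k)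
    (hv1 : ∀ k, v k ≤ 1) (hrec : ∀ k, v (k + 1) = g (v k) + a k) (K : ℕ) :
    v K ≤ v 0 + ∑ k ∈ Finset.range K, a k := by
  induction K with
  | zero => simp
  | succ K ih =>
    rw [Finset.sum_range_succ, hrec]
    linarith [h.le_self (hv0 K) (hv1 K)]

/-- Asymptotics of the sum of the first `K` iterates. -/
lemma tendsto_sum_iterate_div (h : CritMap f α) (hα : α < 1) {x N : ℕ → ℝ} {K : ℕ → ℕ} {d : ℝ}
    (hx : Tendsto x atTop (𝓝[>] 0)) (hN : ∀ᶠ n in atTop, 0 < N n)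
    (hd : Tendsto (fun n => x n * hitTime f (x n) / N n) atTop (𝓝 d))
    (hK : Tendsto (fun n => f^[K n] (x n) * hitTime f (f^[K n] (x n)) / N n) atTop (𝓝 0)) :
    Tendsto (fun n => (∑ k ∈ Finset.range (K n), f^[k] (x n)) / N n) atTop
      (𝓝 (d / (1 / α - 1))) := by
  have hpos := h.pos
  have hb : 0 < 1 / α - 1 := by
    have := one_lt_one_div hpos hα; linarith
  set H : ℝ → ℝ := fun x => x * hitTime f x with hH
  have hD : Tendsto (fun n => (H (x n) - H (f^[K n] (x n))) / N n) atTop (𝓝 d) := by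
    have := hd.sub hK
    rw [sub_zero] at this
    exact this.congr fun n => by simp only [hH]; ring
  have key : ∀ p q, p < 1 / α - 1 → 1 / α - 1 < q → ∀ᶠ n in atTop,
      p * ∑ k ∈ Finset.range (K n), f^[k] (x n) ≤ H (x n) - H (f^[K n] (x n)) ∧
      H (x n) - H (f^[K n] (x n)) ≤ q * ∑ k ∈ Finset.range (K n), f^[k] (x n) := by
    intro p q hp hq
    have hev := ((h.tendsto_mul_hitTime_decrement.eventually_const_lt hp).and
      (h.tendsto_mul_hitTime_decrement.eventually_lt_const hq)).and (eventually_mem_Ioc one_pos)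
    obtain ⟨δ, hδ, hδ'⟩ := mem_nhdsGT_iff_exists_Ioc_subset.1 hev
    have hδ0 : 0 < δ := hδ
    have hδ1 : δ ≤ 1 := (hδ' ⟨hδ0, le_rfl⟩).2.2
    filter_upwards [hx.eventually (eventually_mem_Ioc hδ0)] with n hn
    have e : H (x n) - H (f^[K n] (x n)) =
        ∑ k ∈ Finset.range (K n), (H (f^[k] (x n)) - H (f^[k + 1] (x n))) := by
      rw [Finset.sum_range_sub' (fun k => H (f^[k] (x n)))]; rfl
    have hpt : ∀ k, p * f^[k] (x n) ≤ H (f^[k] (x n)) - H (f^[k + 1] (x n)) ∧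
        H (f^[k] (x n)) - H (f^[k + 1] (x n)) ≤ q * f^[k] (x n) := by
      intro k
      have hm := h.iterate_mem hn.1 (hn.2.trans hδ1) k
      obtain ⟨⟨q1, q2⟩, -⟩ := hδ' ⟨hm.1, hm.2.trans hn.2⟩
      rw [lt_div_iff₀ hm.1] at q1
      rw [div_lt_iff₀ hm.1] at q2
      rw [Function.iterate_succ_apply']
      exact ⟨q1.le, q2.le⟩
    rw [e, Finset.mul_sum, Finset.mul_sum]
    exact ⟨Finset.sum_le_sum fun k _ => (hpt k).1, Finset.sum_le_sum fun k _ => (hpt k).2⟩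
  have hcont : ContinuousAt (fun p : ℝ => d / p) (1 / α - 1) :=
    continuousAt_const.div continuousAt_id hb.ne'
  refine tendsto_order.2 ⟨fun a ha => ?_, fun a ha => ?_⟩
  · obtain ⟨q, hq1, hq2⟩ := (((hcont.tendsto.mono_left nhdsWithin_le_nhds).eventually_const_lt
      ha).and (self_mem_nhdsWithin (s := Set.Ioi (1 / α - 1)))).exists
    have hq2 : 1 / α - 1 < q := hq2
    have hq0 : 0 < q := hb.trans hq2
    filter_upwards [key 0 q hb hq2, (hD.div_const q).eventually_const_lt hq1, hN] with n h1 h2 h3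
    refine h2.trans_le ?_
    rw [div_right_comm]
    have := h1.2
    gcongr
    rw [div_le_iff₀ hq0]; linarith
  · obtain ⟨p, hp1, hp0, hp2⟩ := (((hcont.tendsto.mono_left nhdsWithin_le_nhds).eventually_lt_const
      ha).and (Ioo_mem_nhdsLT hb)).exists
    filter_upwards [key p (1 / α) hp2 (by linarith), (hD.div_const p).eventually_lt_const hp1, hN]
      with n h1 h2 h3
    refine lt_of_le_of_lt ?_ h2
    rw [div_right_comm]
    have := h1.1
    gcongr
    rw [le_div_iff₀ hp0]; linarith

/-- Running the map for `m ~ β n` steps from `w ~ c g^[n] 1`. -/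
lemma tendsto_iterate_div_iterate_one (h : CritMap g α) {w : ℕ → ℝ} {m : ℕ → ℕ} {c β : ℝ}
    (hc : 0 < c) (hβ : 0 ≤ β) (hw : Tendsto (fun n => w n / g^[n] 1) atTop (𝓝 c))
    (hm : Tendsto (fun n : ℕ => (m n : ℝ) / n) atTop (𝓝 β)) :
    Tendsto (fun n => g^[m n] (w n) / g^[n] 1) atTop (𝓝 ((β + c ^ (-α)) ^ (-1 / α))) := by
  have hq := h.tendsto_iterate_one
  have hq0 : ∀ n, 0 < g^[n] 1 := fun n => (h.iterate_mem one_pos le_rfl n).1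
  have hwpos : ∀ᶠ n in atTop, 0 < w n := by
    filter_upwards [hw.eventually_const_lt hc] with n hn
    have := mul_pos hn (hq0 n)
    rwa [div_mul_cancel₀ _ (hq0 n).ne'] at this
  have hw0 : Tendsto w atTop (𝓝[>] 0) := by
    refine tendsto_nhdsWithin_iff.2 ⟨?_, hwpos⟩
    have := hw.mul (tendsto_nhds_of_tendsto_nhdsWithin hq)
    rw [mul_zero] at this
    refine this.congr fun n => ?_
    exact div_mul_cancel₀ _ (hq0 n).ne'
  have h1 : Tendsto (fun n => hitTime g (w n) / n) atTop (𝓝 (c ^ (-α))) := by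
    have := (h.tendsto_hitTime_div hc hw0 hq hw).mul h.tendsto_hitTime_iterate_one_div
    rw [mul_one] at this
    refine this.congr' ?_
    filter_upwards [(h.tendsto_hitTime.comp hq).eventually_gt_atTop 0] with n hn
    simp only [Function.comp] at hn
    field_simp
  have hnpos : ∀ᶠ n : ℕ in atTop, (0 : ℝ) < n := by
    filter_upwards [eventually_gt_atTop 0] with n hn
    exact_mod_cast hn
  have h2 := h.tendsto_hitTime_iterate_div hw0 hnpos h1 hm
  have hcpos : 0 < c ^ (-α) := Real.rpow_pos_of_pos hc _
  have hx : Tendsto (fun n => g^[m n] (w n)) atTop (𝓝[>] 0) := by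
    refine tendsto_nhdsWithin_iff.2 ⟨?_, ?_⟩
    · refine tendsto_of_tendsto_of_tendsto_of_le_of_le' tendsto_const_nhds
        (tendsto_nhds_of_tendsto_nhdsWithin hw0) ?_ ?_
      all_goals
        filter_upwards [hw0.eventually (eventually_mem_Ioc one_pos)] with n hn
        have := h.iterate_mem hn.1 hn.2 (m n)
        first | exact this.1.le | exact this.2
    · filter_upwards [hw0.eventually (eventually_mem_Ioc one_pos)] with n hn
      exact (h.iterate_mem hn.1 hn.2 (m n)).1
  refine h.tendsto_div_of_hitTime (by linarith) hx hq ?_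
  have h3 := h2.div h.tendsto_hitTime_iterate_one_div one_ne_zero
  rw [div_one, add_comm] at h3
  refine h3.congr' ?_
  filter_upwards [hnpos, (h.tendsto_hitTime.comp hq).eventually_gt_atTop 0] with n hn hn'
  simp only [Function.comp, Pi.div_apply] at hn' ⊢
  field_simp

lemma tendsto_natFloor_mul_div {ε : ℝ} (hε : 0 ≤ ε) :
    Tendsto (fun n : ℕ => (⌊ε * (n : ℝ)⌋₊ : ℝ) / n) atTop (𝓝 ε) :=
  (tendsto_nat_floor_mul_div_atTop hε).comp tendsto_natCast_atTop_atTop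

lemma tendsto_natFloor_mul {ε : ℝ} (hε : 0 < ε) :
    Tendsto (fun n : ℕ => ⌊ε * (n : ℝ)⌋₊) atTop atTop :=
  tendsto_nat_floor_atTop.comp (tendsto_natCast_atTop_atTop.const_mul_atTop hε)

lemma tendsto_iterate_natFloor_div (h : CritMap f α) {ε : ℝ} (hε : 0 < ε) :
    Tendsto (fun n : ℕ => f^[⌊ε * (n : ℝ)⌋₊] 1 / f^[n] 1) atTop (𝓝 (ε ^ (-1 / α))) :=
  h.tendsto_iterate_one_div hε (tendsto_natFloor_mul hε) tendsto_id
    (tendsto_natFloor_mul_div hε.le)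

lemma iterate_one_pos (h : CritMap f α) (n : ℕ) : 0 < f^[n] 1 :=
  (h.iterate_mem one_pos le_rfl n).1

/-- If `T n = o(n)` and `T n → ∞` then the iterates at time `n` are negligible against those at
time `T n`. -/
lemma tendsto_iterate_div_iterate_of_isLittleO (h : CritMap g β) {T : ℕ → ℕ}
    (hTn : Tendsto (fun n : ℕ => (T n : ℝ) / n) atTop (𝓝 0)) :
    Tendsto (fun n : ℕ => g^[n] 1 / g^[T n] 1) atTop (𝓝 0) := by
  refine tendsto_order.2 ⟨fun a ha => ?_, fun a ha => ?_⟩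
  · exact Eventually.of_forall fun n =>
      ha.trans (div_pos (h.iterate_one_pos n) (h.iterate_one_pos _))
  · have hβ := h.pos
    have hlim : Tendsto (fun δ : ℝ => δ ^ (1 / β)) (𝓝[>] 0) (𝓝 0) := by
      have := (Real.continuousAt_rpow_const 0 (1 / β) (Or.inr (by positivity))).tendsto
      rw [Real.zero_rpow (by positivity)] at this
      exact this.mono_left nhdsWithin_le_nhds
    obtain ⟨δ, hδ, hδ0⟩ := ((hlim.eventually_lt_const ha).and
      (self_mem_nhdsWithin (s := Set.Ioi (0 : ℝ)))).exists
    have hδ0 : 0 < δ := hδ0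
    have h1 := (h.tendsto_iterate_natFloor_div hδ0).inv₀ (Real.rpow_pos_of_pos hδ0 _).ne'
    have e : (δ ^ (-1 / β))⁻¹ = δ ^ (1 / β) := by
      rw [← Real.rpow_neg hδ0.le]; congr 1; ring
    rw [e] at h1
    filter_upwards [h1.eventually_lt_const hδ, hTn.eventually_lt_const hδ0, eventually_gt_atTop 0]
      with n h2 h3 h4
    refine lt_of_le_of_lt ?_ h2
    rw [inv_div]
    have hn : (0 : ℝ) < n := by exact_mod_cast h4
    rw [div_lt_iff₀ hn] at h3
    have := h.iterate_anti one_pos le_rfl (Nat.le_floor h3.le)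
    have := h.iterate_one_pos n
    have := h.iterate_one_pos ⌊δ * (n : ℝ)⌋₊
    gcongr

lemma tendsto_scale_atTop (hf : CritMap f α) (hg : CritMap g β) (hκ : 0 < κ)
    (hh : Tendsto (fun n => hs n * f^[hs n] 1 / g^[n] 1) atTop (𝓝 κ)) :
    Tendsto hs atTop atTop := by
  refine tendsto_atTop.2 fun M => ?_
  have hq := tendsto_nhds_of_tendsto_nhdsWithin hg.tendsto_iterate_one
  have h1 := hh.mul hq
  rw [mul_zero] at h1
  filter_upwards [h1.eventually_lt_const (hf.iterate_one_pos M), hh.eventually_const_lt hκ]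
    with n h2 h3
  by_contra hcon
  rw [div_mul_cancel₀ _ (hg.iterate_one_pos n).ne'] at h2
  have h4 : hs n ≠ 0 := by
    intro h0; simp [h0] at h3
  have h5 : (1 : ℝ) ≤ hs n := by exact_mod_cast Nat.one_le_iff_ne_zero.2 h4
  have h6 := hf.iterate_anti one_pos le_rfl (show hs n ≤ M by omega)
  have := hf.iterate_one_pos M
  nlinarith

lemma tendsto_scale_div (hf : CritMap f α) (hα : α < 1) (hg : CritMap g β) (hκ : 0 < κ)
    (hA : Tendsto (fun n : ℕ => n * f^[n] 1 / g^[n] 1) atTop (𝓝 0))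
    (hh : Tendsto (fun n => hs n * f^[hs n] 1 / g^[n] 1) atTop (𝓝 κ)) :
    Tendsto (fun n : ℕ => (hs n : ℝ) / n) atTop (𝓝 0) := by
  have hsT := tendsto_scale_atTop hf hg hκ hh
  set E : ℕ → ℝ := fun k => f^[k] 1 * hitTime f (f^[k] 1) with hE
  have hEk : Tendsto (fun k : ℕ => E k / (k * f^[k] 1)) atTop (𝓝 1) := by
    refine hf.tendsto_hitTime_iterate_one_div.congr fun k => ?_
    have := (hf.iterate_one_pos k).ne'
    simp only [hE]
    rw [mul_comm (k : ℝ), mul_div_mul_left _ _ this]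
  have hb : 0 < 1 / α - 1 := by
    have := one_lt_one_div hf.pos hα; linarith
  obtain ⟨N, hN⟩ := eventually_atTop.1 ((hf.tendsto_mul_hitTime_decrement.comp
    hf.tendsto_iterate_one).eventually_const_lt hb)
  have hanti : ∀ k l, N ≤ k → k ≤ l → E l ≤ E k := by
    intro k l hk hkl
    induction l, hkl using Nat.le_induction with
    | base => exact le_rfl
    | succ l hl ih =>
      refine le_trans ?_ ih
      have h1 := hN l (hk.trans hl)
      have h2 := hf.iterate_one_pos l
      simp only [Function.comp, div_pos_iff_of_pos_right h2] at h1
      simp only [hE]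
      rw [Function.iterate_succ_apply']
      linarith
  have hEh : Tendsto (fun n => E (hs n) / g^[n] 1) atTop (𝓝 κ) := by
    have := (hEk.comp hsT).mul hh
    rw [one_mul] at this
    refine this.congr' ?_
    filter_upwards [hsT.eventually_gt_atTop 0] with n hn
    have h1 : (hs n : ℝ) ≠ 0 := by positivity
    have h2 := (hf.iterate_one_pos (hs n)).ne'
    simp only [Function.comp]
    field_simp
  refine tendsto_order.2 ⟨fun a ha => ?_, fun a ha => ?_⟩
  · exact Eventually.of_forall fun n => ha.trans_le (by positivity)
  · obtain ⟨ε, hε0, hεa⟩ := exists_between ha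
    have hK := tendsto_natFloor_mul hε0
    have hEK : Tendsto (fun n : ℕ => E ⌊ε * (n : ℝ)⌋₊ / g^[n] 1) atTop (𝓝 0) := by
      have := (((hEk.comp hK).mul (tendsto_natFloor_mul_div hε0.le)).mul
        (hf.tendsto_iterate_natFloor_div hε0)).mul hA
      rw [mul_zero] at this
      refine this.congr' ?_
      filter_upwards [hK.eventually_gt_atTop 0, eventually_gt_atTop 0] with n hn hn'
      have h1 : (⌊ε * (n : ℝ)⌋₊ : ℝ) ≠ 0 := by positivity
      have h2 := (hf.iterate_one_pos ⌊ε * (n : ℝ)⌋₊).ne'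
      have h3 := (hf.iterate_one_pos n).ne'
      have h4 : (n : ℝ) ≠ 0 := by positivity
      simp only [Function.comp]
      field_simp
    obtain ⟨r, hr0, hr1⟩ := exists_between hκ
    filter_upwards [hEK.eventually_lt_const hr0, hEh.eventually_const_lt hr1,
      hsT.eventually_ge_atTop N, hK.eventually_ge_atTop N, eventually_gt_atTop 0]
      with n h1 h2 h3 h4 h5
    have hn : (0 : ℝ) < n := by exact_mod_cast h5
    have hlt : hs n ≤ ⌊ε * (n : ℝ)⌋₊ := by
      by_contra hcon
      have h6 := hanti _ _ h4 (not_le.1 hcon).le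
      have := hg.iterate_one_pos n
      have h7 : E (hs n) / g^[n] 1 ≤ E ⌊ε * (n : ℝ)⌋₊ / g^[n] 1 := by gcongr
      linarith
    have h8 : (hs n : ℝ) ≤ ε * n := (Nat.cast_le.2 hlt).trans (Nat.floor_le (by positivity))
    rw [div_lt_iff₀ hn]
    nlinarith

/-- The sum of the iterates of `f` started from `σ f^[⌊t h⌋] 1` up to time `ε n`. -/
lemma tendsto_sum_iterate_scale (hf : CritMap f α) (hα : α < 1) (hg : CritMap g β) (hκ : 0 < κ)
    (hA : Tendsto (fun n : ℕ => n * f^[n] 1 / g^[n] 1) atTop (𝓝 0))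
    (hh : Tendsto (fun n => hs n * f^[hs n] 1 / g^[n] 1) atTop (𝓝 κ)) {t σ ε : ℝ} (ht : 0 < t)
    (hσ0 : 0 < σ) (hσ1 : σ ≤ 1) (hε : 0 < ε) :
    Tendsto (fun n : ℕ => (∑ k ∈ Finset.range ⌊ε * (n : ℝ)⌋₊,
        f^[k] (σ * f^[⌊t * (hs n : ℝ)⌋₊] 1)) / g^[n] 1) atTop
      (𝓝 (t ^ (1 - 1 / α) * σ ^ (1 - α) * κ / (1 / α - 1))) := by
  have hsT := tendsto_scale_atTop hf hg hκ hh
  have hsn := tendsto_scale_div hf hα hg hκ hA hh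
  have hT : Tendsto (fun n => ⌊t * (hs n : ℝ)⌋₊) atTop atTop := (tendsto_natFloor_mul ht).comp hsT
  have hTh : Tendsto (fun n => (⌊t * (hs n : ℝ)⌋₊ : ℝ) / hs n) atTop (𝓝 t) :=
    (tendsto_natFloor_mul_div ht.le).comp hsT
  have hTn : Tendsto (fun n : ℕ => (⌊t * (hs n : ℝ)⌋₊ : ℝ) / n) atTop (𝓝 0) := by
    have := hTh.mul hsn
    rw [mul_zero] at this
    refine this.congr' ?_
    filter_upwards [hsT.eventually_gt_atTop 0] with n hn
    have h1 : (hs n : ℝ) ≠ 0 := by positivity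
    field_simp
  set T : ℕ → ℕ := fun n => ⌊t * (hs n : ℝ)⌋₊ with hTdef
  change Tendsto T atTop atTop at hT
  change Tendsto (fun n => (T n : ℝ) / hs n) atTop (𝓝 t) at hTh
  change Tendsto (fun n : ℕ => (T n : ℝ) / n) atTop (𝓝 0) at hTn
  have hQT := hf.tendsto_iterate_one.comp hT
  have hx : Tendsto (fun n => σ * f^[T n] 1) atTop (𝓝[>] 0) := by
    refine tendsto_nhdsWithin_iff.2 ⟨?_, Eventually.of_forall fun n =>
      mul_pos hσ0 (hf.iterate_one_pos _)⟩
    simpa using (tendsto_nhds_of_tendsto_nhdsWithin hQT).const_mul σ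
  have hΦx : Tendsto (fun n => hitTime f (σ * f^[T n] 1) / hitTime f (f^[T n] 1)) atTop
      (𝓝 (σ ^ (-α))) := (hf.tendsto_hitTime_mul_div hσ0).comp hQT
  have hΦT : Tendsto (fun n => hitTime f (f^[T n] 1) / T n) atTop (𝓝 1) :=
    hf.tendsto_hitTime_iterate_one_div.comp hT
  have hΦpos : ∀ᶠ n in atTop, 0 < hitTime f (f^[T n] 1) :=
    (hf.tendsto_hitTime.comp hQT).eventually_gt_atTop 0
  have hnpos : ∀ᶠ n : ℕ in atTop, (0 : ℝ) < n := by
    filter_upwards [eventually_gt_atTop 0] with n hn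
    exact_mod_cast hn
  refine hf.tendsto_sum_iterate_div hα hx (Eventually.of_forall fun n => hg.iterate_one_pos n)
    ?_ ?_
  · have hQ := hf.tendsto_iterate_one_div ht hT hsT hTh
    have h1 := ((((hQ.const_mul σ).mul hΦx).mul hΦT).mul hTh).mul hh
    have e : σ * t ^ (-1 / α) * σ ^ (-α) * 1 * t * κ = t ^ (1 - 1 / α) * σ ^ (1 - α) * κ := by
      rw [sub_eq_add_neg 1 (1 / α), sub_eq_add_neg 1 α, Real.rpow_add ht, Real.rpow_add hσ0,
        Real.rpow_one, Real.rpow_one, neg_div]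
      ring
    rw [e] at h1
    refine h1.congr' ?_
    filter_upwards [hT.eventually_gt_atTop 0, hsT.eventually_gt_atTop 0, hΦpos] with n h2 h3 h4
    have h2 : (T n : ℝ) ≠ 0 := by positivity
    have h3 : (hs n : ℝ) ≠ 0 := by positivity
    have h5 := (hf.iterate_one_pos (hs n)).ne'
    change _ = σ * f^[T n] 1 * hitTime f (σ * f^[T n] 1) / g^[n] 1
    field_simp
  · have hxn : Tendsto (fun n : ℕ => hitTime f (σ * f^[T n] 1) / n) atTop (𝓝 0) := by
      have := (hΦx.mul hΦT).mul hTn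
      rw [mul_zero] at this
      refine this.congr' ?_
      filter_upwards [hT.eventually_gt_atTop 0, hΦpos] with n h2 h4
      have h2 : (T n : ℝ) ≠ 0 := by positivity
      field_simp
    have hΦK := hf.tendsto_hitTime_iterate_div hx hnpos hxn (tendsto_natFloor_mul_div hε.le)
    have hub := ((hf.tendsto_iterate_natFloor_div hε).mul hΦK).mul hA
    rw [mul_zero] at hub
    have hx1 : ∀ n, σ * f^[T n] 1 ≤ 1 := fun n =>
      mul_le_one₀ hσ1 (hf.iterate_one_pos _).le (hf.iterate_mem one_pos le_rfl _).2
    have hx0 : ∀ n, 0 < σ * f^[T n] 1 := fun n => mul_pos hσ0 (hf.iterate_one_pos _)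
    have hmem := fun n : ℕ => hf.iterate_mem (hx0 n) (hx1 n) ⌊ε * (n : ℝ)⌋₊
    have hΦ0 := fun n => hf.hitTime_nonneg (hmem n).1 ((hmem n).2.trans (hx1 n))
    refine tendsto_of_tendsto_of_tendsto_of_le_of_le' tendsto_const_nhds hub ?_ ?_
    · exact Eventually.of_forall fun n => div_nonneg (mul_nonneg (hmem n).1.le (hΦ0 n))
        (hg.iterate_one_pos n).le
    · filter_upwards [hnpos] with n hn
      have h1 := hf.iterate_mono (hx0 n) (hx1 n) le_rfl ⌊ε * (n : ℝ)⌋₊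
      have h2 := (hf.iterate_one_pos n).ne'
      have h3 := hg.iterate_one_pos n
      have h4 := hΦ0 n
      have e : ∀ y z : ℝ, y / f^[n] 1 * (z / n) * (n * f^[n] 1 / g^[n] 1) = y * z / g^[n] 1 := by
        intro y z; field_simp
      rw [e]
      gcongr

/-- The total immigration after time `ε n` is negligible. -/
lemma tendsto_tail_bound (hf : CritMap f α)
    (hA : Tendsto (fun n : ℕ => n * f^[n] 1 / g^[n] 1) atTop (𝓝 0)) {ε : ℝ} (hε : 0 < ε) (A : ℝ) :
    Tendsto (fun n : ℕ => A * (n * f^[⌊ε * (n : ℝ)⌋₊] 1) / g^[n] 1) atTop (𝓝 0) := by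
  have := ((hf.tendsto_iterate_natFloor_div hε).mul hA).const_mul A
  rw [mul_zero, mul_zero] at this
  refine this.congr fun n => ?_
  have h2 := (hf.iterate_one_pos n).ne'
  field_simp

lemma tail_sum_le (hf : CritMap f α) {A : ℝ} (hA0 : 0 ≤ A) {a : ℕ → ℝ} 
    (ha : ∀ k, a k ≤ A * f^[k] 1) {K m n : ℕ} (hmn : m ≤ n) :
    ∑ k ∈ Finset.Ico K m, a k ≤ A * (n * f^[K] 1) := by
  calc ∑ k ∈ Finset.Ico K m, a k ≤ ∑ _k ∈ Finset.Ico K m, A * f^[K] 1 := by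
        refine Finset.sum_le_sum fun k hk => (ha k).trans ?_
        have := hf.iterate_anti one_pos le_rfl (Finset.mem_Ico.1 hk).1
        gcongr
    _ = ((m - K : ℕ) : ℝ) * (A * f^[K] 1) := by simp
    _ ≤ n * (A * f^[K] 1) := by
        have := hf.iterate_one_pos K
        have : ((m - K : ℕ) : ℝ) ≤ n := by exact_mod_cast (by omega : m - K ≤ n)
        gcongr
    _ = _ := by ring

/-- Negligible immigration does not change the asymptotics of the iteration started from `1`. -/
lemma tendsto_perturbed_one_div (hf : CritMap f α) (hg : CritMap g β)
    (hA : Tendsto (fun n : ℕ => n * f^[n] 1 / g^[n] 1) atTop (𝓝 0)) {A : ℝ} (hA0 : 0 ≤ A)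
    {v : ℕ → ℝ} (hv0 : v 0 = 1) (hv : ∀ k, 0 ≤ v k ∧ v k ≤ 1) (hlow : ∀ k, g (v k) ≤ v (k + 1))
    (hup : ∀ k, v (k + 1) ≤ g (v k) + A * f^[k] 1) :
    Tendsto (fun n => v n / g^[n] 1) atTop (𝓝 1) := by
  have hge : ∀ n, g^[n] 1 ≤ v n := by
    intro n
    induction n with
    | zero => simp [hv0]
    | succ n ih =>
      rw [Function.iterate_succ_apply']
      exact (hg.mono _ _ (hg.iterate_one_pos n).le ih (hv n).2).trans (hlow n)
  refine tendsto_order.2 ⟨fun a ha => Eventually.of_forall fun n => ha.trans_le ?_, fun a ha => ?_⟩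
  · rw [le_div_iff₀ (hg.iterate_one_pos n), one_mul]; exact hge n
  · have hc : Tendsto (fun ε : ℝ => (1 - ε) ^ (-1 / β)) (𝓝[>] 0) (𝓝 1) := by
      have : ContinuousAt (fun ε : ℝ => (1 - ε) ^ (-1 / β)) 0 :=
        ContinuousAt.rpow_const (by fun_prop) (Or.inl (by norm_num))
      have := this.tendsto
      rw [sub_zero, Real.one_rpow] at this
      exact this.mono_left nhdsWithin_le_nhds
    obtain ⟨ε, hεa, hε0, hε1⟩ := ((hc.eventually_lt_const ha).and
      (Ioo_mem_nhdsGT (show (0 : ℝ) < 1 by norm_num))).exists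
    have hKle : ∀ n : ℕ, ⌊ε * (n : ℝ)⌋₊ ≤ n := fun n => by
      refine Nat.floor_le_of_le ?_
      have : (0 : ℝ) ≤ n := by positivity
      nlinarith
    have hratio : Tendsto (fun n : ℕ => ((n - ⌊ε * (n : ℝ)⌋₊ : ℕ) : ℝ) / n) atTop (𝓝 (1 - ε)) := by
      have := (tendsto_natFloor_mul_div hε0.le).const_sub 1
      refine this.congr' ?_
      filter_upwards [eventually_gt_atTop 0] with n hn
      have : (n : ℝ) ≠ 0 := by positivity
      rw [Nat.cast_sub (hKle n)]
      field_simp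
    have hmT : Tendsto (fun n : ℕ => n - ⌊ε * (n : ℝ)⌋₊) atTop atTop := by
      have h1 : (0 : ℝ) < 1 - ε := by linarith
      have := hratio.pos_mul_atTop h1 (tendsto_natCast_atTop_atTop (R := ℝ))
      refine tendsto_natCast_atTop_iff (R := ℝ).1 (this.congr' ?_)
      filter_upwards [eventually_gt_atTop 0] with n hn
      have : (n : ℝ) ≠ 0 := by positivity
      field_simp
    have h1 := hg.tendsto_iterate_one_div (by linarith) hmT tendsto_id hratio
    have h2 := h1.add (tendsto_tail_bound hf hA hε0 A)
    rw [add_zero] at h2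
    filter_upwards [h2.eventually_lt_const hεa] with n hn
    refine lt_of_le_of_lt ?_ hn
    rw [id, ← add_div]
    have h3 := hg.perturbed_le_iterate (v := v) (a := fun k => v (k + 1) - g (v k))
      (fun k => (hv k).1) (fun k => (hv k).2) (fun k => sub_nonneg.2 (hlow k)) (fun k => by ring)
      (hKle n) one_pos le_rfl (hv _).2
    have h4 := hf.tail_sum_le hA0 (a := fun k => v (k + 1) - g (v k)) (K := ⌊ε * (n : ℝ)⌋₊)
      (fun k => by linarith [hup k]) le_rfl (m := n)
    have := hg.iterate_one_pos n
    gcongr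
    linarith

/-- Asymptotics of the total immigration before time `K n` when it is `≈ A u` for small `u`, `v`. -/
lemma tendsto_sum_immigration (hg : CritMap g β) {A s b : ℝ} (hA0 : 0 < A)
    {u v : ℕ → ℕ → ℝ} {K : ℕ → ℕ} {u0 N : ℕ → ℝ} (hN : ∀ᶠ n in atTop, 0 < N n)
    (hN0 : Tendsto N atTop (𝓝 0)) (hu0 : Tendsto u0 atTop (𝓝 0)) (hu : ∀ n k, 0 ≤ u n k)
    (huu : ∀ n k, u n k ≤ u0 n) (hv : ∀ n k, 0 ≤ v n k ∧ v n k ≤ 1)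
    (hup : ∀ n k, v n (k + 1) ≤ g (v n k) + A * u n k)
    (hlow : ∀ ε, 0 < ε → ∃ δ, 0 < δ ∧ ∀ n k, u n k < δ → v n k < δ →
      g (v n k) + (A - ε) * u n k ≤ v n (k + 1))
    (hsum : Tendsto (fun n => (∑ k ∈ Finset.range (K n), u n k) / N n) atTop (𝓝 s))
    (hvz : Tendsto (fun n => v n 0 / N n) atTop (𝓝 b)) :
    Tendsto (fun n => (v n 0 + ∑ k ∈ Finset.range (K n), (v n (k + 1) - g (v n k))) / N n) atTop
      (𝓝 (b + A * s)) := by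
  have hvsmall : Tendsto (fun n => v n 0 + A * ∑ k ∈ Finset.range (K n), u n k) atTop (𝓝 0) := by
    have := (hvz.add (hsum.const_mul A)).mul hN0
    rw [mul_zero] at this
    refine this.congr' ?_
    filter_upwards [hN] with n hn
    field_simp
  have hvle : ∀ n k, k ≤ K n → v n k ≤ v n 0 + A * ∑ k ∈ Finset.range (K n), u n k := by
    intro n k hk
    have h1 := hg.perturbed_le_sum (v := v n) (a := fun k => v n (k + 1) - g (v n k))
      (fun k => (hv n k).1) (fun k => (hv n k).2) (fun k => by ring) k
    have h2 : ∑ k ∈ Finset.range k, (v n (k + 1) - g (v n k)) ≤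
        ∑ k ∈ Finset.range k, A * u n k :=
      Finset.sum_le_sum fun i _ => by linarith [hup n i]
    have h3 : ∑ k ∈ Finset.range k, A * u n k ≤ ∑ k ∈ Finset.range (K n), A * u n k :=
      Finset.sum_le_sum_of_subset_of_nonneg (Finset.range_mono hk)
        (fun i _ _ => mul_nonneg hA0.le (hu n i))
    rw [Finset.mul_sum]
    linarith
  refine tendsto_order.2 ⟨fun a ha => ?_, fun a ha => ?_⟩
  · have hc : Tendsto (fun ε : ℝ => b + (A - ε) * s) (𝓝[>] 0) (𝓝 (b + A * s)) := by
      have : Continuous (fun ε : ℝ => b + (A - ε) * s) := by fun_prop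
      have := this.tendsto 0
      rw [sub_zero] at this
      exact this.mono_left nhdsWithin_le_nhds
    obtain ⟨ε, hεa, hε0⟩ := ((hc.eventually_const_lt ha).and
      (self_mem_nhdsWithin (s := Set.Ioi (0 : ℝ)))).exists
    obtain ⟨δ, hδ0, hδ⟩ := hlow ε hε0
    filter_upwards [(hvz.add (hsum.const_mul (A - ε))).eventually_const_lt hεa, hN,
      hu0.eventually_lt_const hδ0, hvsmall.eventually_lt_const hδ0] with n h1 h2 h3 h4
    refine h1.trans_le ?_
    rw [← mul_div_assoc, ← add_div, Finset.mul_sum]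
    gcongr with k hk
    have := hδ n k ((huu n k).trans_lt h3)
      ((hvle n k (Finset.mem_range.1 hk).le).trans_lt h4)
    linarith
  · filter_upwards [(hvz.add (hsum.const_mul A)).eventually_lt_const ha, hN] with n h1 h2
    refine lt_of_le_of_lt ?_ h1
    rw [← mul_div_assoc, ← add_div, Finset.mul_sum]
    gcongr with k hk
    linarith [hup n k]

lemma tendsto_scale_of_normalized (hα0 : 0 < α) (hα : α < 1) (hg : CritMap g β) {A : ℝ}
    (hA0 : 0 < A)
    (hh : Tendsto (fun n => α * A / (1 - α) * hs n * f^[hs n] 1 / g^[n] 1) atTop (𝓝 1)) :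
    Tendsto (fun n => hs n * f^[hs n] 1 / g^[n] 1) atTop (𝓝 ((1 - α) / (α * A))) := by
  have h1α : 0 < 1 - α := by linarith
  have := hh.const_mul ((1 - α) / (α * A))
  rw [mul_one] at this
  refine this.congr fun n => ?_
  have := (hg.iterate_one_pos n).ne'
  field_simp

lemma tendsto_natFloor_scale_div (hf : CritMap f α) (hα : α < 1) (hg : CritMap g β) {A t : ℝ}
    (hA0 : 0 < A) (hA : Tendsto (fun n : ℕ => n * f^[n] 1 / g^[n] 1) atTop (𝓝 0))
    (hh : Tendsto (fun n => α * A / (1 - α) * hs n * f^[hs n] 1 / g^[n] 1) atTop (𝓝 1))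
    (ht : 0 ≤ t) : Tendsto (fun n : ℕ => (⌊t * (hs n : ℝ)⌋₊ : ℝ) / n) atTop (𝓝 0) := by
  have hα0 := hf.pos
  have h1α : 0 < 1 - α := by linarith
  have hκ : 0 < (1 - α) / (α * A) := by positivity
  have hh' := tendsto_scale_of_normalized hα0 hα hg hA0 hh
  have hsT := tendsto_scale_atTop hf hg hκ hh'
  have := ((tendsto_natFloor_mul_div ht).comp hsT).mul (tendsto_scale_div hf hα hg hκ hA hh')
  rw [mul_zero] at this
  refine this.congr' ?_
  filter_upwards [hsT.eventually_gt_atTop 0] with n hn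
  have h1 : (hs n : ℝ) ≠ 0 := by positivity
  simp only [Function.comp]
  field_simp

/-- Limit of the perturbed iteration on the scale `h*`. -/
theorem tendsto_perturbed_scale (hf : CritMap f α) (hα : α < 1) (hg : CritMap g β) {A : ℝ}
    (hA0 : 0 < A) (hA : Tendsto (fun n : ℕ => n * f^[n] 1 / g^[n] 1) atTop (𝓝 0))
    (hh : Tendsto (fun n => α * A / (1 - α) * hs n * f^[hs n] 1 / g^[n] 1) atTop (𝓝 1))
    {t σ b : ℝ} (ht : 0 < t) (hσ0 : 0 < σ) (hσ1 : σ ≤ 1) (hb : 0 ≤ b)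
    {u v : ℕ → ℕ → ℝ} (hu : ∀ n k, u n k = f^[k] (σ * f^[⌊t * (hs n : ℝ)⌋₊] 1))
    (hv : ∀ n k, 0 ≤ v n k ∧ v n k ≤ 1) (hvg : ∀ n k, g (v n k) ≤ v n (k + 1))
    (hup : ∀ n k, v n (k + 1) ≤ g (v n k) + A * u n k)
    (hlow : ∀ ε, 0 < ε → ∃ δ, 0 < δ ∧ ∀ n k, u n k < δ → v n k < δ →
      g (v n k) + (A - ε) * u n k ≤ v n (k + 1))
    (hvz : Tendsto (fun n => v n 0 / g^[n] 1) atTop (𝓝 b)) :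
    Tendsto (fun n => v n (n - ⌊t * (hs n : ℝ)⌋₊) / g^[n] 1) atTop
      (𝓝 ((1 + (t ^ (1 - 1 / α) * σ ^ (1 - α) + b) ^ (-β)) ^ (-1 / β))) := by
  have hα0 := hf.pos
  have h1α : 0 < 1 - α := by linarith
  set κ := (1 - α) / (α * A) with hκdef
  have hκ : 0 < κ := by positivity
  have hh' : Tendsto (fun n => hs n * f^[hs n] 1 / g^[n] 1) atTop (𝓝 κ) :=
    tendsto_scale_of_normalized hα0 hα hg hA0 hh
  have hsT := tendsto_scale_atTop hf hg hκ hh'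
  have hsn := tendsto_scale_div hf hα hg hκ hA hh'
  have hT : Tendsto (fun n => ⌊t * (hs n : ℝ)⌋₊) atTop atTop := (tendsto_natFloor_mul ht).comp hsT
  have hTn := tendsto_natFloor_scale_div hf hα hg hA0 hA hh ht.le
  have hq0 := hg.iterate_one_pos
  set c := t ^ (1 - 1 / α) * σ ^ (1 - α) + b with hcdef
  have hc : 0 < c := by
    have := Real.rpow_pos_of_pos ht (1 - 1 / α)
    have := Real.rpow_pos_of_pos hσ0 (1 - α)
    positivity
  have hx0 : ∀ n, 0 < σ * f^[⌊t * (hs n : ℝ)⌋₊] 1 := fun n => mul_pos hσ0 (hf.iterate_one_pos _)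
  have hx1 : ∀ n, σ * f^[⌊t * (hs n : ℝ)⌋₊] 1 ≤ 1 := fun n =>
    mul_le_one₀ hσ1 (hf.iterate_one_pos _).le (hf.iterate_mem one_pos le_rfl _).2
  have hu0 : Tendsto (fun n => σ * f^[⌊t * (hs n : ℝ)⌋₊] 1) atTop (𝓝 0) := by
    simpa using ((tendsto_nhds_of_tendsto_nhdsWithin hf.tendsto_iterate_one).comp hT).const_mul σ
  have humem : ∀ n k, 0 < u n k ∧ u n k ≤ σ * f^[⌊t * (hs n : ℝ)⌋₊] 1 := fun n k => by
    rw [hu]; exact hf.iterate_mem (hx0 n) (hx1 n) k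
  have hule : ∀ n k, u n k ≤ f^[k] 1 := fun n k => by
    rw [hu]; exact hf.iterate_mono (hx0 n) (hx1 n) le_rfl k
  have hw : ∀ ε, 0 < ε → Tendsto (fun n : ℕ => (v n 0 + ∑ k ∈ Finset.range ⌊ε * (n : ℝ)⌋₊,
      (v n (k + 1) - g (v n k))) / g^[n] 1) atTop (𝓝 c) := by
    intro ε hε
    have h1 := tendsto_sum_iterate_scale hf hα hg hκ hA hh' ht hσ0 hσ1 hε
    simp_rw [← hu] at h1
    have h2 := tendsto_sum_immigration hg hA0 (Eventually.of_forall hq0)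
      (tendsto_nhds_of_tendsto_nhdsWithin hg.tendsto_iterate_one) hu0
      (fun n k => (humem n k).1.le) (fun n k => (humem n k).2) hv hup hlow h1 hvz
    have e : b + A * (t ^ (1 - 1 / α) * σ ^ (1 - α) * κ / (1 / α - 1)) = c := by
      have h3 : 1 / α - 1 = (1 - α) / α := by field_simp
      rw [hcdef, h3, hκdef]; field_simp; ring
    rwa [e] at h2
  have hwsmall : ∀ ε, 0 < ε → ∀ᶠ n : ℕ in atTop, 0 < v n 0 + ∑ k ∈ Finset.range ⌊ε * (n : ℝ)⌋₊,
      (v n (k + 1) - g (v n k)) ∧ v n 0 + ∑ k ∈ Finset.range ⌊ε * (n : ℝ)⌋₊,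
      (v n (k + 1) - g (v n k)) ≤ 1 := by
    intro ε hε
    have h1 := (hw ε hε).mul (tendsto_nhds_of_tendsto_nhdsWithin hg.tendsto_iterate_one)
    rw [mul_zero] at h1
    filter_upwards [(hw ε hε).eventually_const_lt hc, h1.eventually_lt_const one_pos] with n h2 h3
    rw [div_mul_cancel₀ _ (hq0 n).ne'] at h3
    exact ⟨(div_pos_iff_of_pos_right (hq0 n)).1 h2, h3.le⟩
  -- the number of remaining steps
  have hsteps : ∀ ε : ℝ, 0 ≤ ε → ε < 1 →
      (∀ᶠ n : ℕ in atTop, ⌊ε * (n : ℝ)⌋₊ ≤ n - ⌊t * (hs n : ℝ)⌋₊) ∧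
      Tendsto (fun n : ℕ => ((n - ⌊t * (hs n : ℝ)⌋₊ - ⌊ε * (n : ℝ)⌋₊ : ℕ) : ℝ) / n) atTop
        (𝓝 (1 - ε)) := by
    intro ε hε0 hε1
    have h1 := hTn.add (tendsto_natFloor_mul_div hε0)
    rw [zero_add] at h1
    have h2 : ∀ᶠ n : ℕ in atTop, ⌊t * (hs n : ℝ)⌋₊ + ⌊ε * (n : ℝ)⌋₊ ≤ n := by
      filter_upwards [h1.eventually_lt_const hε1, eventually_gt_atTop 0] with n h3 h4
      have hn : (0 : ℝ) < n := by exact_mod_cast h4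
      rw [← add_div, div_lt_one hn] at h3
      exact_mod_cast h3.le
    refine ⟨by filter_upwards [h2] with n hn; omega, (h1.const_sub 1).congr' ?_⟩
    filter_upwards [h2, eventually_gt_atTop 0] with n h3 h4
    have hn : (n : ℝ) ≠ 0 := by positivity
    rw [Nat.sub_sub, Nat.cast_sub h3, Nat.cast_add]
    field_simp
  have hrec : ∀ n k, v n (k + 1) = g (v n k) + (v n (k + 1) - g (v n k)) := fun n k => by ring
  have ha0 : ∀ n k, 0 ≤ v n (k + 1) - g (v n k) := fun n k => sub_nonneg.2 (hvg n k)
  refine tendsto_order.2 ⟨fun a ha => ?_, fun a ha => ?_⟩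
  · have h1 := hg.tendsto_iterate_div_iterate_one hc zero_le_one (hw (1 / 2) (by norm_num))
      (m := fun n => n - ⌊t * (hs n : ℝ)⌋₊) (by simpa using (hsteps 0 le_rfl one_pos).2)
    filter_upwards [h1.eventually_const_lt ha, hwsmall (1 / 2) (by norm_num),
      (hsteps (1 / 2) (by norm_num) (by norm_num)).1] with n h2 h3 h4
    refine h2.trans_le ?_
    have := hq0 n
    gcongr
    exact hg.iterate_le_of_perturbed (fun k => (hv n k).1) (fun k => (hv n k).2) (ha0 n) (hrec n)
      h4 h3.1 h3.2
  · have hcβ : 0 < c ^ (-β) := Real.rpow_pos_of_pos hc _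
    have hlim : Tendsto (fun ε : ℝ => (1 - ε + c ^ (-β)) ^ (-1 / β)) (𝓝[>] 0)
        (𝓝 ((1 + c ^ (-β)) ^ (-1 / β))) := by
      have : ContinuousAt (fun ε : ℝ => (1 - ε + c ^ (-β)) ^ (-1 / β)) 0 :=
        ContinuousAt.rpow_const (by fun_prop) (Or.inl (by linarith))
      have := this.tendsto
      rw [sub_zero] at this
      exact this.mono_left nhdsWithin_le_nhds
    obtain ⟨ε, hεa, hε0, hε1⟩ := ((hlim.eventually_lt_const ha).and
      (Ioo_mem_nhdsGT (show (0 : ℝ) < 1 by norm_num))).exists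
    have h1 := (hg.tendsto_iterate_div_iterate_one hc (by linarith) (hw ε hε0)
      (hsteps ε hε0.le hε1).2).add (tendsto_tail_bound hf hA hε0 A)
    rw [add_zero] at h1
    filter_upwards [h1.eventually_lt_const hεa, hwsmall ε hε0, (hsteps ε hε0.le hε1).1]
      with n h2 h3 h4
    refine lt_of_le_of_lt ?_ h2
    rw [← add_div]
    have := hq0 n
    gcongr
    refine (hg.perturbed_le_iterate (fun k => (hv n k).1) (fun k => (hv n k).2) (ha0 n) (hrec n)
      h4 h3.1 h3.2 (hg.perturbed_le_sum (fun k => (hv n k).1) (fun k => (hv n k).2) (hrec n)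
      _)).trans ?_
    gcongr
    refine hf.tail_sum_le hA0.le (fun k => ?_) (Nat.sub_le _ _)
    have := mul_le_mul_of_nonneg_left (hule n k) hA0.le
    linarith [hup n k]

/-- Initial values `(1 - exp (-l q / V)) V` are asymptotically `l q`. -/
lemma tendsto_one_sub_exp_mul_div {q V : ℕ → ℝ} {l : ℝ} (hl : 0 ≤ l) (hq : ∀ n, 0 < q n)
    (hV : ∀ n, 0 < V n) (hqV : Tendsto (fun n => q n / V n) atTop (𝓝 0)) :
    Tendsto (fun n => (1 - Real.exp (-(l * q n / V n))) * V n / q n) atTop (𝓝 l) := by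
  have hy : Tendsto (fun n => l * (q n / V n)) atTop (𝓝 0) := by simpa using hqV.const_mul l
  have hlow : Tendsto (fun n => l - l * (l * (q n / V n))) atTop (𝓝 l) := by
    simpa using (hy.const_mul l).const_sub l
  refine tendsto_of_tendsto_of_tendsto_of_le_of_le' hlow tendsto_const_nhds ?_ ?_
  · filter_upwards [hy.eventually_lt_const one_pos] with n hn
    have h1 := hq n
    have h2 := hV n
    rw [← mul_div_assoc] at hn ⊢
    set y := l * q n / V n with hydef
    have hy0 : 0 ≤ y := by positivity
    have h3 := (abs_le.1 (Real.abs_exp_sub_one_sub_id_le (x := -y)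
      (by rw [abs_neg, abs_of_nonneg hy0]; exact hn.le))).2
    rw [le_div_iff₀ h1]
    have e : (l - l * y) * q n = (y - y ^ 2) * V n := by
      rw [hydef]; field_simp
    rw [e]
    have : y - y ^ 2 ≤ 1 - Real.exp (-y) := by nlinarith
    gcongr
  · refine Eventually.of_forall fun n => ?_
    have h1 := hq n
    have h2 := hV n
    rw [div_le_iff₀ h1]
    have h3 := Real.one_sub_le_exp_neg (l * q n / V n)
    calc (1 - Real.exp (-(l * q n / V n))) * V n ≤ (l * q n / V n) * V n := by gcongr; linarith
      _ = l * q n := by field_simp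

end CritMap

section PGF

variable {Ω : Type*} [MeasurableSpace Ω] {P : Measure Ω} [IsProbabilityMeasure P] {X Y : Ω → ℕ}

lemma integrable_pow_mul_pow (hX : Measurable X) (hY : Measurable Y) {a b : ℝ} (ha0 : 0 ≤ a)
    (ha1 : a ≤ 1) (hb0 : 0 ≤ b) (hb1 : b ≤ 1) :
    Integrable (fun ω => a ^ X ω * b ^ Y ω) P := by
  have hm : Measurable (fun ω => a ^ X ω * b ^ Y ω) :=
    ((measurable_from_nat (f := fun n => a ^ n)).comp hX).mul
      ((measurable_from_nat (f := fun n => b ^ n)).comp hY)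
  refine Integrable.of_bound hm.aestronglyMeasurable 1 (ae_of_all _ fun ω => ?_)
  rw [Real.norm_of_nonneg (by positivity)]
  exact mul_le_one₀ (pow_le_one₀ ha0 ha1) (by positivity) (pow_le_one₀ hb0 hb1)

lemma integrable_pow (hX : Measurable X) {a : ℝ} (ha0 : 0 ≤ a) (ha1 : a ≤ 1) :
    Integrable (fun ω => a ^ X ω) P := by
  simpa using integrable_pow_mul_pow (P := P) hX hX ha0 ha1 zero_le_one le_rfl

lemma integral_pow_mul_pow_mem (hX : Measurable X) (hY : Measurable Y) {a b : ℝ} (ha0 : 0 ≤ a)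
    (ha1 : a ≤ 1) (hb0 : 0 ≤ b) (hb1 : b ≤ 1) :
    0 ≤ ∫ ω, a ^ X ω * b ^ Y ω ∂P ∧ ∫ ω, a ^ X ω * b ^ Y ω ∂P ≤ 1 := by
  refine ⟨integral_nonneg fun ω => by positivity, ?_⟩
  refine (integral_mono (integrable_pow_mul_pow hX hY ha0 ha1 hb0 hb1) (integrable_const 1)
    fun ω => mul_le_one₀ (pow_le_one₀ ha0 ha1) (by positivity) (pow_le_one₀ hb0 hb1)).trans ?_
  simp

lemma integral_zero_pow (hX : Measurable X) :
    ∫ ω, (0 : ℝ) ^ X ω ∂P = 1 - (P {ω | X ω ≠ 0}).toReal := by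
  have hs : MeasurableSet {ω | X ω ≠ 0} := (hX (measurableSet_singleton 0)).compl
  have : (fun ω => (0 : ℝ) ^ X ω) = {ω | X ω ≠ 0}ᶜ.indicator 1 := by
    ext ω
    by_cases h : X ω = 0 <;> simp [h]
  rw [this, integral_indicator_one hs.compl, measureReal_compl hs]
  simp [Measure.real]

/-- `bⁿ` is Lipschitz with constant `n` on `[0, 1]`. -/
lemma pow_sub_pow_le_mul {a b : ℝ} (hb : 0 ≤ b) (hba : b ≤ a) (ha : a ≤ 1) (n : ℕ) :
    a ^ n - b ^ n ≤ n * (a - b) := by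
  induction n with
  | zero => simp
  | succ n ih =>
    have h1 : a ^ n ≤ 1 := pow_le_one₀ (hb.trans hba) ha
    have h2 : b ^ n ≤ a ^ n := pow_le_pow_left₀ hb hba n
    rw [pow_succ, pow_succ]
    push_cast
    nlinarith

lemma mul_one_sub_pow_le {x y : ℝ} (hx : 0 ≤ x) (hxy : x ≤ y) (hy : y ≤ 1) (n : ℕ) :
    x * (1 - (1 - y) ^ n) ≤ y * (1 - (1 - x) ^ n) := by
  have hgeom : ∀ z : ℝ, 1 - (1 - z) ^ n = (∑ i ∈ Finset.range n, (1 - z) ^ i) * z := fun z => by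
    have := geom_sum_mul_neg (1 - z) n
    rw [← this]; ring
  rw [hgeom, hgeom]
  have : ∑ i ∈ Finset.range n, (1 - y) ^ i ≤ ∑ i ∈ Finset.range n, (1 - x) ^ i := by
    gcongr
  nlinarith [mul_nonneg hx (hx.trans hxy)]

/-- A critical offspring law in the domain of attraction of an `α + 1`-stable law. -/
lemma CritMap.of_pgf (hX : Measurable X) (hmean : ∫ ω, (X ω : ℝ) ∂P = 1) {f L : ℝ → ℝ} {α : ℝ}
    (hα : 0 < α)
    (hL : ∀ c : ℝ, 0 < c → Tendsto (fun x => L (c * x) / L x) (𝓝[>] 0) (𝓝 1))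
    (hf : ∀ x, f x = 1 - ∫ ω, (1 - x) ^ X ω ∂P)
    (hform : ∀ x, 0 < x → x ≤ 1 → x - f x = x ^ (1 + α) * L x) : CritMap f α where
  pos := hα
  zero := by simp [hf]
  mono x y hx hxy hy := by
    rw [hf, hf]
    gcongr 1 - ?_
    refine integral_mono (integrable_pow hX (by linarith) (by linarith))
      (integrable_pow hX (by linarith) (by linarith)) fun ω => ?_
    exact pow_le_pow_left₀ (by linarith) (by linarith) _
  sub_mono x y hx hxy hy := by
    have hpow : ∀ z : ℝ, 0 ≤ z → z ≤ 1 → Integrable (fun ω => (1 - z) ^ X ω) P := fun z h0 h1 =>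
      integrable_pow hX (by linarith) (by linarith)
    have hXi : Integrable (fun ω => (X ω : ℝ)) P :=
      .of_integral_ne_zero (by rw [hmean]; exact one_ne_zero)
    have h := integral_mono ((hpow x hx (hxy.trans hy)).sub (hpow y (hx.trans hxy) hy))
      (hXi.mul_const (y - x)) fun ω => by
        have := pow_sub_pow_le_mul (a := 1 - x) (b := 1 - y) (by linarith) (by linarith)
          (by linarith) (X ω)
        simpa using this
    simp only [Pi.sub_apply] at h
    rw [integral_sub (hpow x hx (hxy.trans hy)) (hpow y (hx.trans hxy) hy), integral_mul_const,
      hmean] at h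
    rw [hf, hf]
    linarith
  ratio_mono x y hx hxy hy := by
    have hpow : ∀ z : ℝ, 0 ≤ z → z ≤ 1 → Integrable (fun ω => (1 - z) ^ X ω) P := fun z h0 h1 =>
      integrable_pow hX (by linarith) (by linarith)
    have hy0 := hx.trans_le hxy
    have hix := ((integrable_const (1 : ℝ)).sub (hpow x hx.le (hxy.trans hy))).const_mul y
    have hiy := ((integrable_const (1 : ℝ)).sub (hpow y hy0.le hy)).const_mul x
    have h := integral_mono hiy hix fun ω => by
      simpa using mul_one_sub_pow_le hx.le hxy hy (X ω)
    simp only [Pi.sub_apply] at h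
    rw [integral_const_mul, integral_const_mul,
      integral_sub (integrable_const _) (hpow x hx.le (hxy.trans hy)),
      integral_sub (integrable_const _) (hpow y hy0.le hy)] at h
    simp only [integral_const, probReal_univ, smul_eq_mul, mul_one] at h
    rw [div_le_div_iff₀ hx hy0, hf, hf]
    linarith
  regvar c hc := by
    have h := (hL c hc).const_mul (c ^ (1 + α))
    rw [mul_one] at h
    refine h.congr' ?_
    filter_upwards [Ioo_mem_nhdsGT one_pos, Ioo_mem_nhdsGT (show 0 < c⁻¹ by positivity)]
      with x hx hxc
    have hcx : c * x ≤ 1 := by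
      have := mul_le_mul_of_nonneg_left hxc.2.le hc.le
      rwa [mul_inv_cancel₀ hc.ne'] at this
    rw [hform x hx.1 hx.2.le, hform (c * x) (mul_pos hc hx.1) hcx,
      Real.mul_rpow hc.le hx.1.le]
    have := (Real.rpow_pos_of_pos hx.1 (1 + α)).ne'
    rw [mul_right_comm, mul_comm _ (x ^ (1 + α)), mul_div_mul_left _ _ this, mul_div_assoc]

end PGF

namespace GWSetup

attribute [instance] GWSetup.mΩ GWSetup.hprob1 GWSetup.hprob2

variable (S : GWSetup)

/-- One-step map of the non-extinction probability for type-1 particles. -/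
noncomputable def step1 (x : ℝ) : ℝ := 1 - S.F1 1 (1 - x)

/-- One-step map of the non-extinction probability for type-2 particles alone. -/
noncomputable def step2 (x : ℝ) : ℝ := 1 - S.F21 1 1 (1 - x)

lemma critMap_step1 : CritMap S.step1 S.α1 := by
  refine CritMap.of_pgf (S.mZ1 1) S.hcrit1 S.hα1.1 S.hL1 (fun x => rfl) fun x hx hx1 => ?_
  have := S.hF1 (1 - x) (by linarith) (by linarith)
  rw [sub_sub_cancel] at this
  rw [step1, F1, this]
  ring

lemma critMap_step2 : CritMap S.step2 S.α2 := by
  refine CritMap.of_pgf (S.mZ2 1) S.hcrit2 S.hα2.1 S.hL2 (fun x => by simp [step2, F21])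
    fun x hx hx1 => ?_
  have := S.hF2 1 (1 - x) zero_le_one le_rfl (by linarith) (by linarith)
  rw [sub_sub_cancel, sub_self, mul_zero] at this
  rw [step2, F21, this]
  ring

lemma F21_mem (n : ℕ) {s1 s2 : ℝ} (h0 : 0 ≤ s1) (h1 : s1 ≤ 1) (h2 : 0 ≤ s2) (h3 : s2 ≤ 1) :
    0 ≤ S.F21 n s1 s2 ∧ S.F21 n s1 s2 ≤ 1 :=
  integral_pow_mul_pow_mem (S.mZ1 n) (S.mZ2 n) h0 h1 h2 h3

lemma F1_zero (s : ℝ) : S.F1 0 s = s := by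
  have : (fun ω => s ^ S.Z1 0 ω) =ᵐ[S.P1] fun _ => s := by
    filter_upwards [S.hinit1] with ω h
    simp [h.1]
  rw [F1, integral_congr_ae this]
  simp

lemma F21_zero (s1 s2 : ℝ) : S.F21 0 s1 s2 = s2 := by
  have : (fun ω => s1 ^ S.Z1 0 ω * s2 ^ S.Z2 0 ω) =ᵐ[S.P2] fun _ => s2 := by
    filter_upwards [S.hinit2] with ω h
    simp [h.1, h.2]
  rw [F21, integral_congr_ae this]
  simp

lemma F1_succ (n : ℕ) {s : ℝ} (h0 : 0 ≤ s) (h1 : s ≤ 1) :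
    S.F1 (n + 1) s = S.F1 1 (S.F1 n s) := by
  rw [add_comm]
  exact S.hbranch1 1 n s h0 h1

lemma F21_succ (n : ℕ) {s1 s2 : ℝ} (h0 : 0 ≤ s1) (h1 : s1 ≤ 1) (h2 : 0 ≤ s2) (h3 : s2 ≤ 1) :
    S.F21 (n + 1) s1 s2 = S.F21 1 (S.F1 n s1) (S.F21 n s1 s2) := by
  rw [add_comm]
  exact S.hbranch2 1 n s1 s2 h0 h1 h2 h3

lemma one_sub_F1_eq_iterate (n : ℕ) {x : ℝ} (h0 : 0 ≤ x) (h1 : x ≤ 1) :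
    1 - S.F1 n (1 - x) = S.step1^[n] x := by
  induction n with
  | zero => simp [F1_zero]
  | succ n ih =>
    rw [Function.iterate_succ_apply', ← ih, S.F1_succ n (by linarith) (by linarith), step1,
      sub_sub_cancel]

lemma F1_one_right (n : ℕ) : S.F1 n 1 = 1 := by simp [F1]

lemma one_sub_F21_eq_iterate (n : ℕ) {x : ℝ} (h0 : 0 ≤ x) (h1 : x ≤ 1) :
    1 - S.F21 n 1 (1 - x) = S.step2^[n] x := by
  induction n with
  | zero => simp [F21_zero]
  | succ n ih =>
    rw [Function.iterate_succ_apply', ← ih,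
      S.F21_succ n zero_le_one le_rfl (by linarith) (by linarith), step2, sub_sub_cancel,
      F1_one_right]

lemma Q1_eq_iterate (n : ℕ) : S.Q1 n = S.step1^[n] 1 := by
  rw [← S.one_sub_F1_eq_iterate n zero_le_one le_rfl, sub_self, F1, integral_zero_pow (S.mZ1 n),
    sub_sub_cancel, Q1]

lemma Q2_eq_iterate (n : ℕ) : S.Q2 n = S.step2^[n] 1 := by
  rw [← S.one_sub_F21_eq_iterate n zero_le_one le_rfl, sub_self, F21]
  simp only [one_pow, one_mul]
  rw [integral_zero_pow (S.mZ2 n), sub_sub_cancel, Q2]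

lemma Q21_eq (n : ℕ) : S.Q21 n = 1 - S.F21 n 0 0 := by
  have h : S.surv n = {ω | S.Z1 n ω + S.Z2 n ω ≠ 0} := by
    ext ω
    simp [surv]
    tauto
  rw [F21]
  simp only [← pow_add]
  have := integral_zero_pow (P := S.P2) ((S.mZ1 n).add (S.mZ2 n))
  simp only [Pi.add_apply] at this
  rw [this, sub_sub_cancel, Q21, h]

/-- The immigration of type-1 particles into the one-step map is at most its mean. -/
lemma one_sub_F21_bounds {u v : ℝ} (hu0 : 0 ≤ u) (hu1 : u ≤ 1) (hv0 : 0 ≤ v) (hv1 : v ≤ 1) :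
    S.step2 v ≤ 1 - S.F21 1 (1 - u) (1 - v) ∧
      1 - S.F21 1 (1 - u) (1 - v) ≤ S.step2 v + S.A21 * u := by
  have hi := integrable_pow_mul_pow (P := S.P2) (S.mZ1 1) (S.mZ2 1) (a := 1 - u) (b := 1 - v)
    (by linarith) (by linarith) (by linarith) (by linarith)
  have hj := integrable_pow_mul_pow (P := S.P2) (S.mZ1 1) (S.mZ2 1) (a := 1) (b := 1 - v)
    (by linarith) (by linarith) (by linarith) (by linarith)
  have hZ : Integrable (fun ω => (S.Z1 1 ω : ℝ)) S.P2 :=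
    .of_integral_ne_zero (by rw [S.hmean21]; exact S.hA21.ne')
  have hpow : ∀ n : ℕ, (1 - v) ^ n ≤ 1 := fun n => pow_le_one₀ (by linarith) (by linarith)
  have hpow0 : ∀ n : ℕ, 0 ≤ (1 - v) ^ n := fun n => pow_nonneg (by linarith) n
  have hupow : ∀ n : ℕ, (1 - u) ^ n ≤ 1 := fun n => pow_le_one₀ (by linarith) (by linarith)
  constructor
  · have h := integral_mono hi hj fun ω => by
      simpa using mul_le_mul_of_nonneg_right (hupow (S.Z1 1 ω)) (hpow0 (S.Z2 1 ω))
    rw [step2]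
    gcongr 1 - ?_
    exact h
  · have h := integral_mono (hj.sub hi) (hZ.mul_const u) fun ω => by
      have h1 := pow_sub_pow_le_mul (a := 1) (b := 1 - u) (by linarith) (by linarith) le_rfl
        (S.Z1 1 ω)
      have h2 := mul_le_mul_of_nonneg_left (hpow (S.Z2 1 ω)) (sub_nonneg.2 (hupow (S.Z1 1 ω)))
      simp only [Pi.sub_apply, one_pow, one_mul, sub_sub_cancel] at h1 ⊢
      linarith
    simp only [Pi.sub_apply] at h
    rw [integral_sub hj hi, integral_mul_const, S.hmean21] at h
    rw [step2, F21, F21]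
    linarith

/-- The immigration is decreasing in the argument of the type-2 population. -/
lemma immigration_anti {u v w : ℝ} (hu0 : 0 ≤ u) (hu1 : u ≤ 1) (hv0 : 0 ≤ v) (hvw : v ≤ w)
    (hw1 : w ≤ 1) :
    1 - S.F21 1 (1 - u) (1 - w) - S.step2 w ≤ 1 - S.F21 1 (1 - u) (1 - v) - S.step2 v := by
  have hi : ∀ a b : ℝ, 0 ≤ a → a ≤ 1 → 0 ≤ b → b ≤ 1 →
      Integrable (fun ω => a ^ S.Z1 1 ω * b ^ S.Z2 1 ω) S.P2 := fun a b h1 h2 h3 h4 =>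
    integrable_pow_mul_pow (S.mZ1 1) (S.mZ2 1) h1 h2 h3 h4
  have h1 := hi 1 (1 - w) zero_le_one le_rfl (by linarith) (by linarith)
  have h2 := hi (1 - u) (1 - w) (by linarith) (by linarith) (by linarith) (by linarith)
  have h3 := hi 1 (1 - v) zero_le_one le_rfl (by linarith) (by linarith)
  have h4 := hi (1 - u) (1 - v) (by linarith) (by linarith) (by linarith) (by linarith)
  have h := integral_mono (h1.sub h2) (h3.sub h4) fun ω => by
    have e1 : (1 - u) ^ S.Z1 1 ω ≤ 1 := pow_le_one₀ (by linarith) (by linarith)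
    have e2 : (1 - w) ^ S.Z2 1 ω ≤ (1 - v) ^ S.Z2 1 ω :=
      pow_le_pow_left₀ (by linarith) (by linarith) _
    simp only [Pi.sub_apply, one_pow, one_mul]
    nlinarith
  simp only [Pi.sub_apply] at h
  rw [integral_sub h1 h2, integral_sub h3 h4] at h
  simp only [step2, F21]
  linarith

/-- For small arguments the immigration is almost `A₂₁ u`. -/
lemma exists_le_one_sub_F21 {ε : ℝ} (hε : 0 < ε) : ∃ δ, 0 < δ ∧ ∀ u v : ℝ, 0 ≤ u → u ≤ 1 →
    0 ≤ v → v ≤ 1 → u < δ → v < δ →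
    S.step2 v + (S.A21 - ε) * u ≤ 1 - S.F21 1 (1 - u) (1 - v) := by
  obtain ⟨δ, hδ, hρ⟩ := S.hρ ε hε
  have hpos : ∀ u v : ℝ, 0 ≤ u → u ≤ 1 → 0 < v → v ≤ 1 → u < δ / 2 → v < δ / 2 →
      S.step2 v + (S.A21 - ε) * u ≤ 1 - S.F21 1 (1 - u) (1 - v) := by
    intro u v hu0 hu1 hv0 hv1 hu hv
    have h1 := S.hF2 (1 - u) (1 - v) (by linarith) (by linarith) (by linarith) (by linarith)
    have h2 := S.hF2 1 (1 - v) (by linarith) (by linarith) (by linarith) (by linarith)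
    have h3 := (abs_lt.1 (hρ (1 - u) (1 - v) (by linarith) (by linarith) (by linarith)
      (by linarith) (by nlinarith))).2
    rw [sub_sub_cancel] at h1 h2
    rw [step2, F21, F21, h1, h2]
    nlinarith
  refine ⟨δ / 2, by positivity, fun u v hu0 hu1 hv0 hv1 hu hv => ?_⟩
  have hw0 : 0 < min 1 (δ / 4) := by positivity
  have hw : max v (min 1 (δ / 4)) < δ / 2 :=
    max_lt hv ((min_le_right _ _).trans_lt (by linarith))
  have hw1 : max v (min 1 (δ / 4)) ≤ 1 := max_le hv1 (min_le_left _ _)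
  have h1 := hpos u _ hu0 hu1 (hw0.trans_le (le_max_right v _)) hw1 hu hw
  have h2 := S.immigration_anti hu0 hu1 hv0 (le_max_left v (min 1 (δ / 4))) hw1
  linarith


lemma setOf_surv_measurable (n : ℕ) : MeasurableSet (S.surv n) :=
  ((S.mZ1 n) (measurableSet_singleton 0)).compl.union ((S.mZ2 n) (measurableSet_singleton 0)).compl

lemma Q2_le_Q21 (n : ℕ) : S.Q2 n ≤ S.Q21 n :=
  ENNReal.toReal_mono (measure_ne_top _ _) (measure_mono fun _ h => Or.inr h)

lemma Q2_pos (n : ℕ) : 0 < S.Q2 n := by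
  rw [Q2_eq_iterate]
  exact S.critMap_step2.iterate_one_pos n

lemma Q21_pos (n : ℕ) : 0 < S.Q21 n := (S.Q2_pos n).trans_le (S.Q2_le_Q21 n)

lemma Q21_le_one (n : ℕ) : S.Q21 n ≤ 1 := by
  rw [Q21_eq]
  linarith [(S.F21_mem n (le_refl 0) zero_le_one (le_refl 0) zero_le_one).1]

/-- The conditional generating function of the reduced process. -/
lemma Ered_pow_mul_pow {m n : ℕ} (hmn : m ≤ n) {s1 s2 : ℝ} (h0 : 0 ≤ s1) (h1 : s1 ≤ 1)
    (h2 : 0 ≤ s2) (h3 : s2 ≤ 1) :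
    S.Ered m n (fun k l => s1 ^ k * s2 ^ l) =
      1 - (1 - S.F21 m (1 - (1 - s1) * S.Q1 (n - m)) (1 - (1 - s2) * S.Q21 (n - m))) / S.Q21 n := by
  have hs := S.setOf_surv_measurable n
  have hi := integrable_pow_mul_pow (P := S.P2) (S.mR1 m n) (S.mR2 m n) h0 h1 h2 h3
  have hsplit := integral_add_compl hs hi
  have hcompl : ∫ ω in (S.surv n)ᶜ, s1 ^ S.R1 m n ω * s2 ^ S.R2 m n ω ∂S.P2 = 1 - S.Q21 n := by
    have : ∀ᵐ ω ∂S.P2, ω ∈ (S.surv n)ᶜ → s1 ^ S.R1 m n ω * s2 ^ S.R2 m n ω = 1 := by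
      filter_upwards [S.hext m n] with ω h hω
      have := h (by simpa [surv] using hω)
      simp [this.1, this.2]
    rw [setIntegral_congr_ae hs.compl this, setIntegral_const, measureReal_compl hs]
    simp [Measure.real, Q21]
  have hred : ∫ ω, s1 ^ S.R1 m n ω * s2 ^ S.R2 m n ω ∂S.P2 =
      S.F21 m (1 - (1 - s1) * S.Q1 (n - m)) (1 - (1 - s2) * S.Q21 (n - m)) :=
    S.hreduced m n hmn s1 s2 h0 h1 h2 h3
  have hQ := (S.Q21_pos n).ne'
  rw [Ered, eq_sub_iff_add_eq, ← add_div, div_eq_one_iff_eq hQ, ← hred]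
  linarith

lemma α1_lt_one_of_isHStar {h : ℕ → ℕ} (hh : S.IsHStar h) : S.α1 < 1 := by
  refine lt_of_le_of_ne S.hα1.2 fun h1 => ?_
  simp only [IsHStar, Asymp, h1, sub_self, div_zero, zero_mul, zero_div] at hh
  exact zero_ne_one (tendsto_nhds_unique tendsto_const_nhds hh)

/-- Under Condition (A), `Q₂₁(n) ~ Q₂(n)`. -/
lemma tendsto_Q21_div_Q2 (hA : S.CondA) :
    Tendsto (fun n => S.Q21 n / S.Q2 n) atTop (𝓝 1) := by
  simp only [CondA, Q1_eq_iterate, Q2_eq_iterate] at hA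
  have hQ1 : ∀ k, S.step1^[k] 1 = 1 - S.F1 k 0 := fun k => by
    rw [← S.one_sub_F1_eq_iterate k zero_le_one le_rfl, sub_self]
  have hQ21 : ∀ k, S.Q21 (k + 1) =
      1 - S.F21 1 (1 - S.step1^[k] 1) (1 - S.Q21 k) := fun k => by
    rw [S.Q21_eq, S.Q21_eq, S.F21_succ k le_rfl zero_le_one le_rfl zero_le_one, hQ1,
      sub_sub_cancel, sub_sub_cancel]
  have hb : ∀ k, S.step2 (S.Q21 k) ≤ S.Q21 (k + 1) ∧
      S.Q21 (k + 1) ≤ S.step2 (S.Q21 k) + S.A21 * S.step1^[k] 1 := fun k => by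
    rw [hQ21]
    have := S.critMap_step1.iterate_mem one_pos le_rfl k
    exact S.one_sub_F21_bounds this.1.le this.2 (S.Q21_pos k).le (S.Q21_le_one k)
  simp only [Q2_eq_iterate]
  exact CritMap.tendsto_perturbed_one_div S.critMap_step1 S.critMap_step2 hA S.hA21.le
    (by simp [Q21_eq, F21_zero]) (fun k => ⟨(S.Q21_pos k).le, S.Q21_le_one k⟩)
    (fun k => (hb k).1) (fun k => (hb k).2)

/-- Under Condition (A), `h* ≪ n`. -/
lemma tendsto_natFloor_mul_isHStar_div (hA : S.CondA) {h : ℕ → ℕ} (hh : S.IsHStar h) {t : ℝ}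
    (ht : 0 ≤ t) : Tendsto (fun n : ℕ => (⌊t * (h n : ℝ)⌋₊ : ℝ) / n) atTop (𝓝 0) := by
  have hα := S.α1_lt_one_of_isHStar hh
  simp only [CondA, IsHStar, Asymp, Q1_eq_iterate, Q2_eq_iterate] at hA hh
  exact CritMap.tendsto_natFloor_scale_div S.critMap_step1 hα S.critMap_step2 S.hA21 hA hh ht

lemma eventually_natFloor_mul_le (hA : S.CondA) {h : ℕ → ℕ} (hh : S.IsHStar h) {t : ℝ}
    (ht : 0 ≤ t) : ∀ᶠ n : ℕ in atTop, ⌊t * (h n : ℝ)⌋₊ ≤ n := by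
  filter_upwards [(S.tendsto_natFloor_mul_isHStar_div hA hh ht).eventually_lt_const one_pos,
    eventually_gt_atTop 0] with n h1 h2
  rw [div_lt_one (by exact_mod_cast h2)] at h1
  exact_mod_cast h1.le

lemma tendsto_Q2_div_Q21_natFloor (hA : S.CondA) {h : ℕ → ℕ} (hh : S.IsHStar h) {t : ℝ}
    (ht : 0 ≤ t) : Tendsto (fun n => S.Q2 n / S.Q21 ⌊t * (h n : ℝ)⌋₊) atTop (𝓝 0) := by
  have := CritMap.tendsto_iterate_div_iterate_of_isLittleO S.critMap_step2
    (S.tendsto_natFloor_mul_isHStar_div hA hh ht)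
  simp only [← Q2_eq_iterate] at this
  refine squeeze_zero (fun n => div_nonneg (S.Q2_pos _).le (S.Q21_pos _).le) (fun n => ?_) this
  exact div_le_div_of_nonneg_left (S.Q2_pos _).le (S.Q2_pos _) (S.Q2_le_Q21 _)

end GWSetup

/-- Theorem `T_ZubQ1`(3).  Under Condition (A), with `h*` as
in (2.1), for `s₁ ∈ (0,1)`, `t > 0`, `λ₂ ≥ 0` and `m = n - ⌊t h*(n)⌋`,
`E[s₁^{Z₁(m,n)} exp(-λ₂ (Q₂(n)/Q₂₁(⌊t h*(n)⌋)) Z₂(m,n)) | Z(n) ≠ 0, Z(0) = e₂]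
  → 1 - (1 + (t^{1-1/α₁}(1-s₁)^{1-α₁} + λ₂)^{-α₂})^{-1/α₂}`. -/
theorem condA_hstar_scale_reduced_pgf (S : GWSetup) (hA : S.CondA)
    (hstar : ℕ → ℕ) (hhstar : S.IsHStar hstar)
    (s1 : ℝ) (hs1 : s1 ∈ Set.Ioo (0 : ℝ) 1)
    (t : ℝ) (ht : 0 < t) (l2 : ℝ) (hl2 : 0 ≤ l2) :
    Filter.Tendsto
      (fun n : ℕ => S.Ered (n - ⌊t * (hstar n : ℝ)⌋₊) n
        (fun k l => s1 ^ k *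
          Real.exp (-(l2 * S.Q2 n / S.Q21 ⌊t * (hstar n : ℝ)⌋₊) * (l : ℝ))))
      Filter.atTop
      (nhds (1 - (1 + (t ^ (1 - 1 / S.α1) * (1 - s1) ^ (1 - S.α1) + l2) ^ (-S.α2))
        ^ (-1 / S.α2))) := by
  obtain ⟨hs0, hs1⟩ := hs1
  have hα := S.α1_lt_one_of_isHStar hhstar
  have hf := S.critMap_step1
  have hg := S.critMap_step2
  have hQ := S.tendsto_Q21_div_Q2 hA
  have hT := S.eventually_natFloor_mul_le hA hhstar ht.le
  have hTQ := S.tendsto_Q2_div_Q21_natFloor hA hhstar ht.le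
  simp only [GWSetup.CondA, GWSetup.IsHStar, Asymp, S.Q1_eq_iterate, S.Q2_eq_iterate]
    at hA hhstar
  set T : ℕ → ℕ := fun n => ⌊t * (hstar n : ℝ)⌋₊ with hTdef
  set s2 : ℕ → ℝ := fun n => Real.exp (-(l2 * S.Q2 n / S.Q21 (T n))) with hs2def
  have hs2 : ∀ n, 0 ≤ s2 n ∧ s2 n ≤ 1 := fun n => by
    have := (S.Q2_pos n).le
    have := (S.Q21_pos (T n)).le
    exact ⟨(Real.exp_pos _).le, Real.exp_le_one_iff.2 (neg_nonpos.2 (by positivity))⟩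
  have hv0 : ∀ n, 0 ≤ (1 - s2 n) * S.Q21 (T n) ∧ (1 - s2 n) * S.Q21 (T n) ≤ 1 := fun n => by
    have h1 := hs2 n
    exact ⟨mul_nonneg (by linarith) (S.Q21_pos _).le,
      mul_le_one₀ (by linarith) (S.Q21_pos _).le (S.Q21_le_one _)⟩
  have hu0 : ∀ n, 0 < (1 - s1) * S.step1^[T n] 1 ∧ (1 - s1) * S.step1^[T n] 1 ≤ 1 := fun n => by
    have h1 := hf.iterate_mem one_pos le_rfl (T n)
    exact ⟨mul_pos (by linarith) h1.1, mul_le_one₀ (by linarith) h1.1.le h1.2⟩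
  set u : ℕ → ℕ → ℝ := fun n k => S.step1^[k] ((1 - s1) * S.step1^[T n] 1) with hudef
  set v : ℕ → ℕ → ℝ := fun n k =>
    1 - S.F21 k (1 - (1 - s1) * S.step1^[T n] 1) (1 - (1 - s2 n) * S.Q21 (T n)) with hvdef
  have hu : ∀ n k, 0 ≤ u n k ∧ u n k ≤ 1 := fun n k => by
    have := hf.iterate_mem (hu0 n).1 (hu0 n).2 k
    exact ⟨this.1.le, this.2.trans (hu0 n).2⟩
  have hv : ∀ n k, 0 ≤ v n k ∧ v n k ≤ 1 := fun n k => by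
    have := S.F21_mem k (s1 := 1 - (1 - s1) * S.step1^[T n] 1)
      (s2 := 1 - (1 - s2 n) * S.Q21 (T n)) (by linarith [(hu0 n).2]) (by linarith [(hu0 n).1])
      (by linarith [(hv0 n).2]) (by linarith [(hv0 n).1])
    exact ⟨by linarith [this.2], by linarith [this.1]⟩
  have hvs : ∀ n k, v n (k + 1) = 1 - S.F21 1 (1 - u n k) (1 - v n k) := fun n k => by
    simp only [hvdef, hudef]
    rw [S.F21_succ k (by linarith [(hu0 n).2]) (by linarith [(hu0 n).1])
      (by linarith [(hv0 n).2]) (by linarith [(hv0 n).1]),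
      ← S.one_sub_F1_eq_iterate k (hu0 n).1.le (hu0 n).2, sub_sub_cancel, sub_sub_cancel]
  have hb := fun n k => S.one_sub_F21_bounds (hu n k).1 (hu n k).2 (hv n k).1 (hv n k).2
  have hmain := CritMap.tendsto_perturbed_scale hf hα hg S.hA21 hA hhstar ht
    (σ := 1 - s1) (by linarith) (by linarith) hl2 (u := u) (v := v) (fun n k => rfl) hv
    (fun n k => by rw [hvs]; exact (hb n k).1) (fun n k => by rw [hvs]; exact (hb n k).2)
    (fun ε hε => by
      obtain ⟨δ, hδ, h⟩ := S.exists_le_one_sub_F21 hε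
      refine ⟨δ, hδ, fun n k h1 h2 => ?_⟩
      rw [hvs]
      exact h _ _ (hu n k).1 (hu n k).2 (hv n k).1 (hv n k).2 h1 h2)
    (by
      have h := CritMap.tendsto_one_sub_exp_mul_div hl2 S.Q2_pos (fun n => S.Q21_pos (T n)) hTQ
      refine h.congr fun n => ?_
      simp only [hvdef]
      rw [S.F21_zero, sub_sub_cancel, ← S.Q2_eq_iterate])
  have hlim := (hmain.div hQ one_ne_zero).const_sub 1
  rw [div_one] at hlim
  refine hlim.congr' ?_
  filter_upwards [hT] with n hn
  have hfun : (fun k l : ℕ => s1 ^ k * Real.exp (-(l2 * S.Q2 n / S.Q21 (T n)) * (l : ℝ))) =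
      fun k l => s1 ^ k * s2 n ^ l := by
    funext k l
    rw [hs2def, ← Real.exp_nat_mul, mul_comm (l : ℝ)]
  have h1 := (S.Q2_pos n).ne'
  have h2 := (S.Q21_pos n).ne'
  change _ = S.Ered (n - T n) n _
  rw [hfun, S.Ered_pow_mul_pow (Nat.sub_le _ _) hs0.le hs1.le (hs2 n).1 (hs2 n).2,
    Nat.sub_sub_self hn, S.Q1_eq_iterate]
  simp only [Pi.div_apply, hvdef]
  rw [← S.Q2_eq_iterate, div_div_div_cancel_right₀ h1]
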